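/- Genus-0 monotone Hurwitz number formula: Let n ≥ 1 and let α = (α_1, …, α_ℓ) be a partition of n with ℓ parts (parts equal to 1 included). Fix a permutation σ of {1, …, n} of cycle type α and set m = n + ℓ − 2. Then the number of transitive factorizations (τ_1, …, τ_m) of σ in which each factor τ_i is a transposition (s_i t_i) with s_i < t_i, subject to the monotonicity condition t_1 ≤ t_2 ≤ ⋯ ≤ t_m, equals, as a rational number, ((2n + ℓ − 3)! / (2n)!) · ∏_{j=1}^{ℓ} α_j · binom(2α_j, α_j). -/

import Mathlib

namespace MonotoneHurwitz

open Finset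

/-! ### Subset convolution of rising factorials -/

section SubsetConvolution

variable {ι : Type*}

/-- The multilinear coefficient on `S` of `B ^ x`, where `B = 1 / (1 - ∑ i, t i * B ^ a i)`. -/
def abelCoeff (a : ι → ℕ) (x : ℕ) (S : Finset ι) : ℕ :=
  match #S with
  | 0 => 1
  | q + 1 => x * (x + ∑ i ∈ S, a i + 1).ascFactorial q

theorem abelCoeff_empty (a : ι → ℕ) (x : ℕ) : abelCoeff a x ∅ = 1 := by
  simp [abelCoeff]

theorem abelCoeff_of_card {a : ι → ℕ} {x : ℕ} {S : Finset ι} {q : ℕ} (h : #S = q + 1) :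
    abelCoeff a x S = x * (x + ∑ i ∈ S, a i + 1).ascFactorial q := by
  simp [abelCoeff, h]

variable [DecidableEq ι]

theorem sum_powerset_mul_comm {R : Type*} [CommSemiring R] (f g : Finset ι → R) (S : Finset ι) :
    ∑ T ∈ S.powerset, f T * g (S \ T) = ∑ T ∈ S.powerset, g T * f (S \ T) := by
  refine Finset.sum_nbij' (fun T => S \ T) (fun T => S \ T) ?_ ?_ ?_ ?_ ?_
  · intro T _; simp
  · intro T _; simp
  · intro T hT; exact Finset.sdiff_sdiff_eq_self (mem_powerset.1 hT)
  · intro T hT; exact Finset.sdiff_sdiff_eq_self (mem_powerset.1 hT)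
  · intro T hT
    rw [Finset.sdiff_sdiff_eq_self (mem_powerset.1 hT), mul_comm]

theorem sum_powerset_sum_erase_mul {R : Type*} [CommSemiring R] (φ : ι → Finset ι → R)
    (g : Finset ι → R) (S : Finset ι) :
    ∑ T ∈ S.powerset, (∑ i ∈ T, φ i (T.erase i)) * g (S \ T) =
      ∑ i ∈ S, ∑ T ∈ (S.erase i).powerset, φ i T * g (S.erase i \ T) := by
  simp_rw [Finset.sum_mul]
  rw [Finset.sum_comm' (t' := S) (s' := fun i => S.powerset.filter (fun T => i ∈ T))]
  · refine Finset.sum_congr rfl fun i hi => ?_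
    refine Finset.sum_nbij' (fun T => T.erase i) (fun T => insert i T) ?_ ?_ ?_ ?_ ?_
    · intro T hT
      simp only [mem_filter, mem_powerset] at hT ⊢
      exact erase_subset_erase i hT.1
    · intro T hT
      simp only [mem_filter, mem_powerset] at hT ⊢
      exact ⟨insert_subset hi (hT.trans (erase_subset _ _)), mem_insert_self _ _⟩
    · intro T hT
      exact insert_erase (mem_filter.1 hT).2
    · intro T hT
      exact erase_insert fun h => notMem_erase i S (mem_powerset.1 hT h)
    · intro T hT
      congr 2
      ext x
      simp only [mem_filter, mem_powerset] at hT
      simp only [mem_sdiff, mem_erase]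
      constructor
      · rintro ⟨h1, h2⟩
        exact ⟨⟨fun h => h2 (h ▸ hT.2), h1⟩, fun h => h2 h.2⟩
      · rintro ⟨⟨h1, h2⟩, h3⟩
        exact ⟨h2, fun h => h3 ⟨h1, h⟩⟩
  · intro T i
    simp only [mem_powerset, mem_filter]
    exact ⟨fun h => ⟨⟨h.1, h.2⟩, h.1 h.2⟩, fun h => h.1⟩

theorem abelCoeff_zero (a : ι → ℕ) (S : Finset ι) :
    abelCoeff a 0 S = if S = ∅ then 1 else 0 := by
  split_ifs with h
  · rw [h, abelCoeff_empty]
  · obtain ⟨q, hq⟩ := Nat.exists_eq_succ_of_ne_zero (card_ne_zero.2 (nonempty_iff_ne_empty.2 h))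
    rw [abelCoeff_of_card hq, zero_mul]

theorem abelCoeff_erase {a : ι → ℕ} {x : ℕ} {S : Finset ι} {q : ℕ} (h : #S = q + 2) {j : ι}
    (hj : j ∈ S) : abelCoeff a (x + a j) (S.erase j) =
      (x + a j) * (x + ∑ i ∈ S, a i + 1).ascFactorial q := by
  rw [abelCoeff_of_card (q := q) (by rw [card_erase_of_mem hj, h]; rfl),
    ← add_sum_erase S a hj, add_assoc x]

theorem abelCoeff_succ (a : ι → ℕ) (x : ℕ) (S : Finset ι) :
    abelCoeff a (x + 1) S =
      abelCoeff a x S + ∑ j ∈ S, abelCoeff a (x + 1 + a j) (S.erase j) := by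
  obtain h | h | ⟨q, h⟩ : #S = 0 ∨ #S = 1 ∨ ∃ q, #S = q + 2 := by
    rcases h : #S with _ | _ | q
    · simp
    · simp
    · exact Or.inr (Or.inr ⟨q, rfl⟩)
  · rw [card_eq_zero] at h
    subst h
    simp [abelCoeff_empty]
  · obtain ⟨j, rfl⟩ := card_eq_one.1 h
    rw [abelCoeff_of_card (q := 0) (by simp), abelCoeff_of_card (q := 0) (by simp)]
    simp [abelCoeff_empty]
  · rw [sum_congr rfl fun j hj => abelCoeff_erase h hj, ← sum_mul, sum_add_distrib,
      abelCoeff_of_card h, abelCoeff_of_card h, sum_const, h, smul_eq_mul]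
    generalize ∑ i ∈ S, a i = d
    rw [show x + 1 + d + 1 = x + d + 1 + 1 by ring, Nat.ascFactorial_succ,
      show (x + d + 1).ascFactorial (q + 1) = (x + d + 1) * (x + d + 1 + 1).ascFactorial q by
        rw [Nat.succ_ascFactorial, Nat.ascFactorial_succ]]
    ring

theorem abelCoeff_conv (a : ι → ℕ) (x y : ℕ) (S : Finset ι) :
    ∑ T ∈ S.powerset, abelCoeff a x T * abelCoeff a y (S \ T) = abelCoeff a (x + y) S := by
  induction hp : #S generalizing x y S with
  | zero =>
    rw [card_eq_zero] at hp
    subst hp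
    simp [abelCoeff_empty]
  | succ p ihp =>
    induction x with
    | zero =>
      simp [abelCoeff_zero]
    | succ x ihx =>
      simp_rw [abelCoeff_succ a x, add_mul]
      rw [sum_add_distrib, ihx,
        sum_powerset_sum_erase_mul (fun j T => abelCoeff a (x + 1 + a j) T),
        show x + 1 + y = x + y + 1 by ring, abelCoeff_succ a (x + y)]
      congr 1
      refine sum_congr rfl fun j hj => ?_
      rw [ihp _ _ _ (by rw [card_erase_of_mem hj, hp]; rfl)]
      congr 1
      ring

end SubsetConvolution

/-! ### Convolution identities for central binomial coefficients -/

/-- For `α = 0`, the coefficient of `z ^ (k + 1)` in `√(1 - 4 z)`; in general, the coefficient of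
`z ^ (k + 1)` in `√(1 - 4 z) * ∑ i ≤ α, C(2 i, i) z ^ (i - α)`. -/
def rootCoeff (k α : ℕ) : ℚ :=
  -(α.centralBinom * (k + 1).centralBinom * (k + 1) * (2 * α + 1)) /
    ((k + 1 + α) * (2 * k + 1))

theorem centralBinom_succ_eq (k : ℕ) :
    ((k + 1).centralBinom : ℚ) = 2 * (2 * k + 1) * k.centralBinom / (k + 1) := by
  have h := Nat.succ_mul_centralBinom_succ k
  have h' : ((k : ℚ) + 1) * (k + 1).centralBinom = 2 * (2 * k + 1) * k.centralBinom := by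
    exact_mod_cast h
  field_simp
  linarith

theorem rootCoeff_succ (k α : ℕ) :
    rootCoeff k (α + 1) = (α + 1).centralBinom * rootCoeff k 0 + rootCoeff (k + 1) α := by
  simp only [rootCoeff]
  rw [centralBinom_succ_eq (k + 1), centralBinom_succ_eq α, Nat.centralBinom_zero]
  push_cast
  field_simp
  ring

theorem rootCoeff_zero_left (α : ℕ) : rootCoeff 0 α = -(α + 1).centralBinom := by
  simp only [rootCoeff]
  rw [centralBinom_succ_eq α, centralBinom_succ_eq 0, Nat.centralBinom_zero]
  push_cast
  field_simp
  ring

theorem rootCoeff_add_swap (α β : ℕ) :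
    rootCoeff β α + rootCoeff α β = -4 * α.centralBinom * β.centralBinom := by
  simp only [rootCoeff]
  rw [centralBinom_succ_eq α, centralBinom_succ_eq β]
  field_simp
  ring

theorem rootCoeff_zero_right (k : ℕ) : rootCoeff k 0 = -2 * catalan k := by
  have h : ((k : ℚ) + 1) * catalan k = k.centralBinom := by
    exact_mod_cast succ_mul_catalan_eq_centralBinom k
  simp only [rootCoeff]
  rw [centralBinom_succ_eq k, ← h, Nat.centralBinom_zero]
  push_cast
  field_simp
  ring

theorem sum_rootCoeff_zero_zero (r : ℕ) :
    ∑ p ∈ antidiagonal r, rootCoeff p.1 0 * rootCoeff p.2 0 = -2 * rootCoeff (r + 1) 0 := by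
  simp_rw [rootCoeff_zero_right]
  rw [catalan_succ']
  push_cast
  rw [mul_sum, mul_sum]
  exact sum_congr rfl fun p _ => by ring

theorem sum_rootCoeff_step {α β : ℕ}
    (h0 : ∀ r, ∑ p ∈ antidiagonal r, rootCoeff p.1 0 * rootCoeff p.2 β =
      -rootCoeff (r + 1 + β) 0 - rootCoeff (r + 1) β)
    (h : ∀ r, ∑ p ∈ antidiagonal r, rootCoeff p.1 α * rootCoeff p.2 β =
      -rootCoeff (r + 1 + β) α - rootCoeff (r + 1 + α) β) (r : ℕ) :
    ∑ p ∈ antidiagonal r, rootCoeff p.1 (α + 1) * rootCoeff p.2 β =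
      -rootCoeff (r + 1 + β) (α + 1) - rootCoeff (r + 1 + (α + 1)) β := by
  simp_rw [rootCoeff_succ _ α, add_mul, mul_assoc]
  rw [sum_add_distrib, ← mul_sum, h0]
  have h2 := h (r + 1)
  rw [Nat.antidiagonal_succ, sum_cons, sum_map] at h2
  simp only [Function.Embedding.coe_prodMap, Function.Embedding.coeFn_mk, Prod.map_fst,
    Prod.map_snd, Function.Embedding.refl_apply, Nat.succ_eq_add_one] at h2
  rw [rootCoeff_zero_left] at h2
  rw [show r + 1 + β + 1 = r + 1 + 1 + β by ring, show r + 1 + (α + 1) = r + 1 + 1 + α by ring]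
  linarith

theorem sum_rootCoeff_swap (r α β : ℕ) :
    ∑ p ∈ antidiagonal r, rootCoeff p.1 α * rootCoeff p.2 β =
      ∑ p ∈ antidiagonal r, rootCoeff p.1 β * rootCoeff p.2 α := by
  rw [← Finset.Nat.sum_antidiagonal_swap]
  exact sum_congr rfl fun p _ => by rw [Prod.fst_swap, Prod.snd_swap, mul_comm]

theorem sum_rootCoeff_mul (r α β : ℕ) :
    ∑ p ∈ antidiagonal r, rootCoeff p.1 α * rootCoeff p.2 β =
      -rootCoeff (r + 1 + β) α - rootCoeff (r + 1 + α) β := by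
  have h0 : ∀ β r, ∑ p ∈ antidiagonal r, rootCoeff p.1 0 * rootCoeff p.2 β =
      -rootCoeff (r + 1 + β) 0 - rootCoeff (r + 1) β := by
    intro β
    induction β with
    | zero =>
      intro r
      rw [sum_rootCoeff_zero_zero, add_zero]
      ring
    | succ β ih =>
      intro r
      rw [sum_rootCoeff_swap, sum_rootCoeff_step (β := 0)]
      · rw [add_zero]; ring
      · intro r; rw [sum_rootCoeff_zero_zero, add_zero]; ring
      · intro r; rw [sum_rootCoeff_swap, ih, add_zero]; ring
  induction α generalizing r with
  | zero => rw [h0, add_zero]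
  | succ α ih => exact sum_rootCoeff_step (h0 β) (fun r => ih r) r

/-! ### The genus-zero recurrence for the closed form -/

section ClosedForm

variable {ι : Type*} [DecidableEq ι]

/-- The genus-zero monotone Hurwitz number for a distinguished cycle of length `r + 1` and further
cycles of lengths `α i`, `i ∈ S`, divided by `∏ i ∈ S, α i * C(2 α i, α i)`. -/
def hurwitzCoeff (α : ι → ℕ) (r : ℕ) (S : Finset ι) : ℚ :=
  -rootCoeff r 0 / 2 * abelCoeff (fun i => 2 * α i) (2 * (r + 1)) S +
    ∑ j ∈ S, rootCoeff r (α j) / (2 * (α j).centralBinom) *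
      abelCoeff (fun i => 2 * α i) (2 * (r + 1) + 2 * α j) (S.erase j)

theorem hurwitzCoeff_eq (α : ι → ℕ) (r : ℕ) (S : Finset ι) :
    hurwitzCoeff α r S = (r + 1) * (r + 1).centralBinom *
      ((2 * (r + 1 + ∑ i ∈ S, α i) + #S - 2).factorial /
        (2 * (r + 1 + ∑ i ∈ S, α i)).factorial) := by
  obtain h | h | ⟨q, h⟩ : #S = 0 ∨ #S = 1 ∨ ∃ q, #S = q + 2 := by
    rcases h : #S with _ | _ | q
    · simp
    · simp
    · exact Or.inr (Or.inr ⟨q, rfl⟩)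
  · rw [card_eq_zero] at h
    subst h
    simp only [hurwitzCoeff, abelCoeff_empty, rootCoeff, sum_empty, card_empty, add_zero]
    rw [show 2 * (r + 1) - 2 = 2 * r by omega, show 2 * (r + 1) = 2 * r + 1 + 1 by ring,
      Nat.factorial_succ, Nat.factorial_succ]
    have := Nat.factorial_ne_zero (2 * r)
    push_cast
    simp only [Nat.centralBinom_zero]
    field_simp
    push_cast
    ring
  · obtain ⟨j, rfl⟩ := card_eq_one.1 h
    have hC : ((α j).centralBinom : ℚ) ≠ 0 := by exact_mod_cast (α j).centralBinom_ne_zero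
    simp only [hurwitzCoeff, sum_singleton, card_singleton]
    rw [abelCoeff_of_card (q := 0) (by simp), erase_singleton, abelCoeff_empty,
      Nat.ascFactorial_zero,
      show 2 * (r + 1 + α j) + 1 - 2 = 2 * (r + α j) + 1 by omega,
      show 2 * (r + 1 + α j) = 2 * (r + α j) + 1 + 1 by ring, Nat.factorial_succ (_ + 1)]
    have := Nat.factorial_ne_zero (2 * (r + α j) + 1)
    simp only [rootCoeff, Nat.centralBinom_zero]
    push_cast
    have e : (2 : ℚ) * (r + α j) + 1 + 1 = 2 * (r + 1 + α j) := by ring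
    rw [e]
    field_simp
    ring
  · simp only [hurwitzCoeff]
    rw [sum_congr rfl fun j hj => by rw [abelCoeff_erase h hj], abelCoeff_of_card h, ← mul_sum]
    have hf := Nat.factorial_mul_ascFactorial (2 * (r + 1) + ∑ i ∈ S, 2 * α i) q
    rw [← mul_sum] at hf
    rw [show 2 * (r + 1 + ∑ i ∈ S, α i) + #S - 2 = 2 * (r + 1) + 2 * ∑ i ∈ S, α i + q by omega,
      show 2 * (r + 1 + ∑ i ∈ S, α i) = 2 * (r + 1) + 2 * ∑ i ∈ S, α i by ring, ← hf,
      Nat.ascFactorial_succ]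
    have hs : ∑ j ∈ S, rootCoeff r (α j) / (2 * (α j).centralBinom) *
        (((2 * (r + 1) + 2 * α j) *
          (2 * (r + 1) + 2 * ∑ i ∈ S, α i + 1).ascFactorial q : ℕ) : ℚ) =
        -((r + 1).centralBinom * (r + 1) / (2 * r + 1)) * (2 * (∑ i ∈ S, α i : ℕ) + #S) *
          ((2 * (r + 1) + 2 * ∑ i ∈ S, α i + 1).ascFactorial q : ℚ) := by
      generalize (2 * (r + 1) + 2 * ∑ i ∈ S, α i + 1).ascFactorial q = z
      push_cast
      rw [card_eq_sum_ones, mul_sum]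
      push_cast
      rw [← sum_add_distrib, mul_sum, sum_mul]
      refine sum_congr rfl fun j _ => ?_
      have hC : ((α j).centralBinom : ℚ) ≠ 0 := by exact_mod_cast (α j).centralBinom_ne_zero
      simp only [rootCoeff]
      field_simp
    rw [hs, h]
    have := Nat.factorial_ne_zero (2 * (r + 1) + 2 * ∑ i ∈ S, α i)
    generalize ∑ i ∈ S, α i = d at *
    simp only [rootCoeff, Nat.centralBinom_zero]
    push_cast
    field_simp
    ring

theorem cast_abelCoeff_conv (a : ι → ℕ) (x y : ℕ) (S : Finset ι) :
    ∑ T ∈ S.powerset, (abelCoeff a x T : ℚ) * abelCoeff a y (S \ T) = abelCoeff a (x + y) S := by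
  exact_mod_cast abelCoeff_conv a x y S

theorem hurwitzCoeff_conv (α : ι → ℕ) (r s : ℕ) (S : Finset ι) :
    ∑ T ∈ S.powerset, hurwitzCoeff α r T * hurwitzCoeff α s (S \ T) =
      rootCoeff r 0 * rootCoeff s 0 / 4 *
        abelCoeff (fun i => 2 * α i) (2 * (r + s + 1 + 1)) S -
      ∑ j ∈ S, (rootCoeff r 0 * rootCoeff s (α j) + rootCoeff r (α j) * rootCoeff s 0) /
        (4 * (α j).centralBinom) *
        abelCoeff (fun i => 2 * α i) (2 * (r + s + 1 + 1) + 2 * α j) (S.erase j) +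
      ∑ j ∈ S, ∑ l ∈ S.erase j, rootCoeff r (α j) * rootCoeff s (α l) /
        (4 * (α j).centralBinom * (α l).centralBinom) *
        abelCoeff (fun i => 2 * α i) (2 * (r + s + 1 + 1) + 2 * α j + 2 * α l)
          ((S.erase j).erase l) := by
  set a : ι → ℕ := fun i => 2 * α i with ha
  have key : ∀ (r s x : ℕ) (S : Finset ι), ∑ T ∈ S.powerset, (∑ j ∈ T, rootCoeff r (α j) /
      (2 * (α j).centralBinom) * (abelCoeff a (2 * (r + 1) + 2 * α j) (T.erase j) : ℚ)) *
      abelCoeff a x (S \ T) = ∑ j ∈ S, rootCoeff r (α j) /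
      (2 * (α j).centralBinom) * abelCoeff a (2 * (r + 1) + x + 2 * α j) (S.erase j) := by
    intro r s x S
    rw [sum_powerset_sum_erase_mul (fun j T => rootCoeff r (α j) /
      (2 * (α j).centralBinom) * (abelCoeff a (2 * (r + 1) + 2 * α j) T : ℚ))
      (fun T => (abelCoeff a x T : ℚ))]
    refine sum_congr rfl fun j _ => ?_
    simp_rw [mul_assoc]
    rw [← mul_sum, cast_abelCoeff_conv, add_right_comm]
  have e1 : ∑ T ∈ S.powerset, hurwitzCoeff α r T * hurwitzCoeff α s (S \ T) =
      -rootCoeff r 0 / 2 * (-rootCoeff s 0 / 2) * ∑ T ∈ S.powerset,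
        (abelCoeff a (2 * (r + 1)) T : ℚ) * abelCoeff a (2 * (s + 1)) (S \ T) +
      -rootCoeff r 0 / 2 * ∑ T ∈ S.powerset, (abelCoeff a (2 * (r + 1)) T : ℚ) *
        ∑ j ∈ S \ T, rootCoeff s (α j) / (2 * (α j).centralBinom) *
          (abelCoeff a (2 * (s + 1) + 2 * α j) ((S \ T).erase j) : ℚ) +
      -rootCoeff s 0 / 2 * ∑ T ∈ S.powerset, (∑ j ∈ T, rootCoeff r (α j) /
        (2 * (α j).centralBinom) * (abelCoeff a (2 * (r + 1) + 2 * α j) (T.erase j) : ℚ)) *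
          abelCoeff a (2 * (s + 1)) (S \ T) +
      ∑ T ∈ S.powerset, (∑ j ∈ T, rootCoeff r (α j) /
        (2 * (α j).centralBinom) * (abelCoeff a (2 * (r + 1) + 2 * α j) (T.erase j) : ℚ)) *
        ∑ j ∈ S \ T, rootCoeff s (α j) / (2 * (α j).centralBinom) *
          (abelCoeff a (2 * (s + 1) + 2 * α j) ((S \ T).erase j) : ℚ) := by
    simp_rw [mul_sum (s := S.powerset), ← sum_add_distrib]
    refine sum_congr rfl fun T _ => ?_
    simp only [hurwitzCoeff]
    ring
  rw [e1, cast_abelCoeff_conv, key r s, sum_powerset_mul_comm (fun T => (abelCoeff a _ T : ℚ))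
      (fun T => ∑ j ∈ T, rootCoeff s (α j) / (2 * (α j).centralBinom) *
          (abelCoeff a (2 * (s + 1) + 2 * α j) (T.erase j) : ℚ)), key s r,
    sum_powerset_sum_erase_mul (fun j T => rootCoeff r (α j) /
      (2 * (α j).centralBinom) * (abelCoeff a (2 * (r + 1) + 2 * α j) T : ℚ))
      (fun T => ∑ j ∈ T, rootCoeff s (α j) / (2 * (α j).centralBinom) *
          (abelCoeff a (2 * (s + 1) + 2 * α j) (T.erase j) : ℚ))]
  rw [show 2 * (s + 1) + 2 * (r + 1) = 2 * (r + s + 1 + 1) by ring,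
    show 2 * (r + 1) + 2 * (s + 1) = 2 * (r + s + 1 + 1) by ring]
  have e2 : ∀ j ∈ S, ∑ T ∈ (S.erase j).powerset, rootCoeff r (α j) /
      (2 * (α j).centralBinom) * (abelCoeff a (2 * (r + 1) + 2 * α j) T : ℚ) *
      ∑ l ∈ S.erase j \ T, rootCoeff s (α l) / (2 * (α l).centralBinom) *
          (abelCoeff a (2 * (s + 1) + 2 * α l) ((S.erase j \ T).erase l) : ℚ) =
      ∑ l ∈ S.erase j, rootCoeff r (α j) * rootCoeff s (α l) /
        (4 * (α j).centralBinom * (α l).centralBinom) *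
        abelCoeff a (2 * (r + s + 1 + 1) + 2 * α j + 2 * α l) ((S.erase j).erase l) := by
    intro j _
    simp_rw [mul_assoc (rootCoeff r (α j) / (2 * (α j).centralBinom))]
    rw [← mul_sum, sum_powerset_mul_comm (fun T => (abelCoeff a _ T : ℚ))
      (fun T => ∑ j ∈ T, rootCoeff s (α j) / (2 * (α j).centralBinom) *
          (abelCoeff a (2 * (s + 1) + 2 * α j) (T.erase j) : ℚ)), key s r, mul_sum]
    refine sum_congr rfl fun l _ => ?_
    rw [show 2 * (s + 1) + (2 * (r + 1) + 2 * α j) + 2 * α l =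
      2 * (r + s + 1 + 1) + 2 * α j + 2 * α l by ring]
    field_simp
    ring
  rw [sum_congr rfl e2, mul_sum, mul_sum]
  congr 1
  rw [add_assoc, ← sum_add_distrib, sub_eq_add_neg, ← sum_neg_distrib]
  congr 1
  · ring
  · refine sum_congr rfl fun j _ => ?_
    have : ((α j).centralBinom : ℚ) ≠ 0 := by exact_mod_cast (α j).centralBinom_ne_zero
    field_simp
    ring

theorem sum_erase_erase_comm (f : ι → ι → ℚ) (S : Finset ι) :
    ∑ j ∈ S, ∑ l ∈ S.erase j, f j l = ∑ j ∈ S, ∑ l ∈ S.erase j, f l j := by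
  refine Finset.sum_comm' fun j l => ?_
  simp only [mem_erase]
  tauto

theorem sum_hurwitzCoeff_div (α : ι → ℕ) (r : ℕ) (S : Finset ι) :
    ∑ j ∈ S, hurwitzCoeff α (r + α j) (S.erase j) / (α j).centralBinom =
      ∑ j ∈ S, -rootCoeff (r + α j) 0 / (2 * (α j).centralBinom) *
        abelCoeff (fun i => 2 * α i) (2 * (r + 1) + 2 * α j) (S.erase j) +
      ∑ j ∈ S, ∑ l ∈ S.erase j, (rootCoeff (r + α j) (α l) + rootCoeff (r + α l) (α j)) /
        (4 * (α j).centralBinom * (α l).centralBinom) *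
        abelCoeff (fun i => 2 * α i) (2 * (r + 1) + 2 * α j + 2 * α l)
          ((S.erase j).erase l) := by
  have e2 : ∑ j ∈ S, hurwitzCoeff α (r + α j) (S.erase j) / (α j).centralBinom =
      ∑ j ∈ S, -rootCoeff (r + α j) 0 / (2 * (α j).centralBinom) *
        abelCoeff (fun i => 2 * α i) (2 * (r + 1) + 2 * α j) (S.erase j) +
      ∑ j ∈ S, ∑ l ∈ S.erase j, rootCoeff (r + α j) (α l) /
        (2 * (α j).centralBinom * (α l).centralBinom) *
        abelCoeff (fun i => 2 * α i) (2 * (r + 1) + 2 * α j + 2 * α l)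
          ((S.erase j).erase l) := by
    rw [← sum_add_distrib]
    refine sum_congr rfl fun j _ => ?_
    simp only [hurwitzCoeff]
    rw [add_div, sum_div]
    congr 1
    · rw [show 2 * (r + α j + 1) = 2 * (r + 1) + 2 * α j by ring]
      field_simp
    · refine sum_congr rfl fun l _ => ?_
      rw [show 2 * (r + α j + 1) = 2 * (r + 1) + 2 * α j by ring]
      field_simp
  have e3 : ∑ j ∈ S, ∑ l ∈ S.erase j, rootCoeff (r + α j) (α l) /
        (2 * (α j).centralBinom * (α l).centralBinom) *
        (abelCoeff (fun i => 2 * α i) (2 * (r + 1) + 2 * α j + 2 * α l)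
          ((S.erase j).erase l) : ℚ) =
      ∑ j ∈ S, ∑ l ∈ S.erase j, (rootCoeff (r + α j) (α l) + rootCoeff (r + α l) (α j)) /
        (4 * (α j).centralBinom * (α l).centralBinom) *
        (abelCoeff (fun i => 2 * α i) (2 * (r + 1) + 2 * α j + 2 * α l)
          ((S.erase j).erase l) : ℚ) := by
    rw [← mul_right_inj' (two_ne_zero' ℚ)]
    nth_rewrite 1 [two_mul]
    nth_rewrite 2 [sum_erase_erase_comm]
    rw [← sum_add_distrib, mul_sum]
    refine sum_congr rfl fun j _ => ?_
    rw [← sum_add_distrib, mul_sum]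
    refine sum_congr rfl fun l _ => ?_
    rw [erase_right_comm, add_right_comm (2 * (r + 1)) (2 * α l)]
    field_simp
    ring
  rw [e2, e3]

theorem hurwitzCoeff_rec_succ (α : ι → ℕ) (r : ℕ) (S : Finset ι) :
    hurwitzCoeff α (r + 1) S =
      ∑ j ∈ S, hurwitzCoeff α (r + 1 + α j) (S.erase j) / (α j).centralBinom +
      ∑ p ∈ antidiagonal r, ∑ T ∈ S.powerset,
        hurwitzCoeff α p.1 T * hurwitzCoeff α p.2 (S \ T) := by
  have e1 : ∑ p ∈ antidiagonal r, ∑ T ∈ S.powerset,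
        hurwitzCoeff α p.1 T * hurwitzCoeff α p.2 (S \ T) =
      (∑ p ∈ antidiagonal r, rootCoeff p.1 0 * rootCoeff p.2 0) / 4 *
        abelCoeff (fun i => 2 * α i) (2 * (r + 1 + 1)) S -
      ∑ j ∈ S, (∑ p ∈ antidiagonal r, rootCoeff p.1 0 * rootCoeff p.2 (α j) +
         ∑ p ∈ antidiagonal r, rootCoeff p.1 (α j) * rootCoeff p.2 0) /
        (4 * (α j).centralBinom) *
        abelCoeff (fun i => 2 * α i) (2 * (r + 1 + 1) + 2 * α j) (S.erase j) +
      ∑ j ∈ S, ∑ l ∈ S.erase j,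
        (∑ p ∈ antidiagonal r, rootCoeff p.1 (α j) * rootCoeff p.2 (α l)) /
        (4 * (α j).centralBinom * (α l).centralBinom) *
        abelCoeff (fun i => 2 * α i) (2 * (r + 1 + 1) + 2 * α j + 2 * α l)
          ((S.erase j).erase l) := by
    simp_rw [← sum_add_distrib, sum_div, sum_mul]
    simp_rw [sum_comm (t := antidiagonal r)]
    rw [← sum_sub_distrib, ← sum_add_distrib]
    refine sum_congr rfl fun p hp => ?_
    rw [hurwitzCoeff_conv, mem_antidiagonal.1 hp]
  rw [e1]
  simp_rw [sum_rootCoeff_mul]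
  rw [sum_hurwitzCoeff_div]
  simp only [hurwitzCoeff]
  simp_rw [add_zero]
  have e4 : ∀ j ∈ S, ∀ l ∈ S.erase j,
      (-rootCoeff (r + 1 + α l) (α j) - rootCoeff (r + 1 + α j) (α l)) /
        (4 * (α j).centralBinom * (α l).centralBinom) *
        (abelCoeff (fun i => 2 * α i) (2 * (r + 1 + 1) + 2 * α j + 2 * α l)
          ((S.erase j).erase l) : ℚ) =
      -((rootCoeff (r + 1 + α j) (α l) + rootCoeff (r + 1 + α l) (α j)) /
        (4 * (α j).centralBinom * (α l).centralBinom) *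
        (abelCoeff (fun i => 2 * α i) (2 * (r + 1 + 1) + 2 * α j + 2 * α l)
          ((S.erase j).erase l) : ℚ)) := by
    intro j _ l _
    ring
  rw [sum_congr rfl fun j hj => sum_congr rfl (e4 j hj)]
  simp_rw [sum_neg_distrib]
  have e5 : ∀ x y u v w z : ℚ, x = v → y = u - w → x + y = u + z + (v - w + -z) := by
    intros; linarith
  apply e5
  · ring
  · rw [← sum_sub_distrib]
    refine sum_congr rfl fun j _ => ?_
    field_simp
    ring

theorem hurwitzCoeff_rec_zero (α : ι → ℕ) {S : Finset ι} (hS : S.Nonempty) :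
    hurwitzCoeff α 0 S =
      ∑ j ∈ S, hurwitzCoeff α (α j) (S.erase j) / (α j).centralBinom := by
  have h := sum_hurwitzCoeff_div α 0 S
  simp only [zero_add, mul_one] at h
  rw [h]
  set a : ι → ℕ := fun i => 2 * α i with ha
  have h0 : abelCoeff a 2 S + ∑ j ∈ S, ∑ l ∈ S.erase j,
      abelCoeff a (2 + 2 * α j + 2 * α l) ((S.erase j).erase l) =
      2 * ∑ j ∈ S, abelCoeff a (2 + 2 * α j) (S.erase j) := by
    have h1 := abelCoeff_succ a 1 S
    have h2 := abelCoeff_succ a 0 S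
    have h3 : ∑ j ∈ S, abelCoeff a (2 + 2 * α j) (S.erase j) =
        ∑ j ∈ S, abelCoeff a (1 + 2 * α j) (S.erase j) + ∑ j ∈ S, ∑ l ∈ S.erase j,
          abelCoeff a (2 + 2 * α j + 2 * α l) ((S.erase j).erase l) := by
      rw [← sum_add_distrib]
      refine sum_congr rfl fun j _ => ?_
      rw [show 2 + 2 * α j = 1 + 2 * α j + 1 by ring, abelCoeff_succ]
    rw [abelCoeff_zero, if_neg hS.ne_empty] at h2
    simp only [zero_add, Nat.reduceAdd] at h1 h2
    simp only [ha] at *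
    omega
  have h0' : (abelCoeff a 2 S : ℚ) + ∑ j ∈ S, ∑ l ∈ S.erase j,
      (abelCoeff a (2 + 2 * α j + 2 * α l) ((S.erase j).erase l) : ℚ) =
      2 * ∑ j ∈ S, (abelCoeff a (2 + 2 * α j) (S.erase j) : ℚ) := by
    exact_mod_cast h0
  have hC : ∀ j, ((α j).centralBinom : ℚ) ≠ 0 := fun j => by
    exact_mod_cast (α j).centralBinom_ne_zero
  have h1 : ∑ j ∈ S, ∑ l ∈ S.erase j, (rootCoeff (α j) (α l) + rootCoeff (α l) (α j)) /
        (4 * (α j).centralBinom * (α l).centralBinom) *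
        (abelCoeff a (2 + 2 * α j + 2 * α l) ((S.erase j).erase l) : ℚ) =
      -∑ j ∈ S, ∑ l ∈ S.erase j,
        (abelCoeff a (2 + 2 * α j + 2 * α l) ((S.erase j).erase l) : ℚ) := by
    simp_rw [← sum_neg_distrib]
    refine sum_congr rfl fun j _ => sum_congr rfl fun l _ => ?_
    have := hC j
    have := hC l
    rw [rootCoeff_add_swap]
    field_simp
  have h2 : ∑ j ∈ S, -rootCoeff (α j) 0 / (2 * (α j).centralBinom) *
        (abelCoeff a (2 + 2 * α j) (S.erase j) : ℚ) =
      2 * ∑ j ∈ S, (abelCoeff a (2 + 2 * α j) (S.erase j) : ℚ) +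
      ∑ j ∈ S, rootCoeff 0 (α j) / (2 * (α j).centralBinom) *
        (abelCoeff a (2 + 2 * α j) (S.erase j) : ℚ) := by
    rw [mul_sum, ← sum_add_distrib]
    refine sum_congr rfl fun j _ => ?_
    have := hC j
    have e := rootCoeff_add_swap 0 (α j)
    rw [Nat.centralBinom_zero] at e
    push_cast at e
    rw [show -rootCoeff (α j) 0 = 4 * (α j).centralBinom + rootCoeff 0 (α j) by linarith]
    field_simp
    ring
  have hc : Nat.centralBinom 1 = 2 := rfl
  rw [h1, h2, hurwitzCoeff, rootCoeff_zero_left]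
  simp only [zero_add, mul_one, ← ha, hc]
  push_cast
  linarith

end ClosedForm

/-! ### Transitive monotone factorizations supported on a finite set -/

section Factorizations

open Equiv

variable {β : Type*}

/-- `B` is a union of connected components of the graph with edge list `l`. -/
def IsSaturated (l : List (β × β)) (B : Finset β) : Prop :=
  ∀ e ∈ l, e.1 ∈ B ↔ e.2 ∈ B

theorem isSaturated_cons {e : β × β} {l : List (β × β)} {B : Finset β} :
    IsSaturated (e :: l) B ↔ (e.1 ∈ B ↔ e.2 ∈ B) ∧ IsSaturated l B :=
  List.forall_mem_cons

theorem IsSaturated.filter {l : List (β × β)} {B : Finset β} (hB : IsSaturated l B)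
    (p : β × β → Bool) : IsSaturated (l.filter p) B :=
  fun e he => hB e (List.mem_of_mem_filter he)

/-- The graph with edge list `l` connects the points of `A`. -/
def IsConn (A : Finset β) (l : List (β × β)) : Prop :=
  ∀ B ⊆ A, B.Nonempty → IsSaturated l B → B = A

theorem IsConn.cons {A : Finset β} {l : List (β × β)} (h : IsConn A l) (e : β × β) :
    IsConn A (e :: l) := fun B hB hne hcl => h B hB hne (isSaturated_cons.1 hcl).2

variable [LinearOrder β]

/-- The product, from right to left, of the transpositions listed in `l`. -/
def swapProd (l : List (β × β)) : Perm β :=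
  (l.reverse.map fun e => swap e.1 e.2).prod

theorem swapProd_cons (e : β × β) (l : List (β × β)) :
    swapProd (e :: l) = swapProd l * swap e.1 e.2 := by
  simp [swapProd]

/-- The list `l` consists of transpositions of `A` and is monotone from right to left. -/
structure IsMonotoneList (A : Finset β) (l : List (β × β)) : Prop where
  lt : ∀ e ∈ l, e.1 < e.2
  fst_mem : ∀ e ∈ l, e.1 ∈ A
  snd_mem : ∀ e ∈ l, e.2 ∈ A
  pairwise : l.Pairwise fun e e' => e'.2 ≤ e.2

theorem isMonotoneList_cons {A : Finset β} {n s : β} (hn : n ∈ A) (hmax : ∀ a ∈ A, a ≤ n)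
    (hs : s ∈ A.erase n) {l : List (β × β)} :
    IsMonotoneList A ((s, n) :: l) ↔ IsMonotoneList A l := by
  rw [mem_erase] at hs
  constructor
  · rintro ⟨h1, h2, h3, h4⟩
    rw [List.forall_mem_cons] at h1 h2 h3
    rw [List.pairwise_cons] at h4
    exact ⟨h1.2, h2.2, h3.2, h4.2⟩
  · rintro ⟨h1, h2, h3, h4⟩
    refine ⟨?_, ?_, ?_, ?_⟩
    · rw [List.forall_mem_cons]
      exact ⟨lt_of_le_of_ne (hmax s hs.2) hs.1, h1⟩
    · rw [List.forall_mem_cons]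
      exact ⟨hs.2, h2⟩
    · rw [List.forall_mem_cons]
      exact ⟨hn, h3⟩
    · rw [List.pairwise_cons]
      exact ⟨fun e he => hmax _ (h3 e he), h4⟩

theorem swapProd_apply_filter {l : List (β × β)} {B : Finset β} (h : IsSaturated l B) {a : β}
    (ha : a ∈ B) : swapProd l a ∈ B ∧ swapProd (l.filter (·.2 ∈ B)) a = swapProd l a := by
  induction l generalizing a with
  | nil => simpa [swapProd] using ha
  | cons e l ih =>
    have he : e.1 ∈ B ↔ e.2 ∈ B := h e (by simp)
    have hl : IsSaturated l B := fun e' he' => h e' (by simp [he'])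
    by_cases heB : e.2 ∈ B
    · have hmem : swap e.1 e.2 a ∈ B := by
        rw [swap_apply_def]
        split_ifs
        exacts [heB, he.2 heB, ha]
      rw [List.filter_cons_of_pos (by simpa using heB), swapProd_cons, swapProd_cons,
        Perm.mul_apply, Perm.mul_apply]
      exact ih hl hmem
    · have hfix : swap e.1 e.2 a = a :=
        swap_apply_of_ne_of_ne (fun h => heB (he.1 (h ▸ ha))) (fun h => heB (h ▸ ha))
      rw [List.filter_cons_of_neg (by simpa using heB), swapProd_cons, Perm.mul_apply, hfix]
      exact ih hl ha

theorem IsMonotoneList.isSaturated {A : Finset β} {l : List (β × β)} (h : IsMonotoneList A l) :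
    IsSaturated l A := fun e he => ⟨fun _ => h.snd_mem e he, fun _ => h.fst_mem e he⟩

theorem IsMonotoneList.isSaturated_sdiff {A B : Finset β} {l : List (β × β)}
    (h : IsMonotoneList A l) (hB : IsSaturated l B) : IsSaturated l (A \ B) := by
  intro e he
  rw [mem_sdiff, mem_sdiff, hB e he]
  exact and_congr_left fun _ => h.isSaturated e he

theorem IsMonotoneList.filter_notMem {A B : Finset β} {l : List (β × β)}
    (h : IsMonotoneList A l) : l.filter (·.2 ∉ B) = l.filter (·.2 ∈ A \ B) := by
  refine List.filter_congr fun e he => ?_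
  simp [h.snd_mem e he]

theorem IsMonotoneList.filter {A B : Finset β} {l : List (β × β)}
    (h : IsMonotoneList A l) (hB : IsSaturated l B) : IsMonotoneList B (l.filter (·.2 ∈ B)) := by
  refine ⟨fun e he => h.lt e (List.mem_of_mem_filter he), fun e he => ?_, fun e he => ?_,
    h.pairwise.filter _⟩
  · have := List.mem_filter.1 he
    exact (hB e this.1).2 (by simpa using this.2)
  · simpa using (List.mem_filter.1 he).2

theorem eq_of_filter_eq {B : Finset β} {l l' : List (β × β)}
    (hl : l.Pairwise fun e e' => e'.2 ≤ e.2) (hl' : l'.Pairwise fun e e' => e'.2 ≤ e.2)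
    (h1 : l.filter (·.2 ∈ B) = l'.filter (·.2 ∈ B))
    (h2 : l.filter (·.2 ∉ B) = l'.filter (·.2 ∉ B)) : l = l' := by
  have hmem : ∀ e, e ∈ l ↔ e ∈ l' := by
    intro e
    by_cases he : e.2 ∈ B
    · have h := congrArg (e ∈ ·) h1
      simpa [List.mem_filter, he] using h
    · have h := congrArg (e ∈ ·) h2
      simpa [List.mem_filter, he] using h
  induction l generalizing l' with
  | nil => exact (List.eq_nil_iff_forall_not_mem.2 fun e he => by simpa using (hmem e).2 he).symm
  | cons e l ih =>
    cases l' with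
    | nil => simpa using (hmem e).1 (by simp)
    | cons e' l' =>
      rw [List.pairwise_cons] at hl hl'
      have hle : e.2 = e'.2 := by
        apply le_antisymm
        · rcases List.mem_cons.1 ((hmem e).1 (by simp)) with h | h
          · rw [h]
          · exact hl'.1 e h
        · rcases List.mem_cons.1 ((hmem e').2 (by simp)) with h | h
          · rw [h]
          · exact hl.1 e' h
      have key : e = e' ∧ l.filter (·.2 ∈ B) = l'.filter (·.2 ∈ B) ∧
          l.filter (·.2 ∉ B) = l'.filter (·.2 ∉ B) := by
        by_cases he : e.2 ∈ B
        · have he' : e'.2 ∈ B := hle ▸ he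
          simp only [List.filter_cons, he, he', decide_true, if_true, not_true_eq_false,
            decide_false, Bool.false_eq_true, if_false, List.cons.injEq] at h1 h2
          exact ⟨h1.1, h1.2, h2⟩
        · have he' : e'.2 ∉ B := hle ▸ he
          simp only [List.filter_cons, he, he', decide_true, if_true, not_false_eq_true,
            decide_false, Bool.false_eq_true, if_false, List.cons.injEq] at h1 h2
          exact ⟨h2.1, h1, h2.2⟩
      obtain ⟨rfl, k1, k2⟩ := key
      congr 1
      refine ih hl.2 hl'.2 k1 k2 fun x => ?_
      by_cases hx : x.2 ∈ B
      · have h := congrArg (x ∈ ·) k1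
        simpa [List.mem_filter, hx] using h
      · have h := congrArg (x ∈ ·) k2
        simpa [List.mem_filter, hx] using h

theorem exists_shuffle {B : Finset β} : ∀ {l₁ l₂ : List (β × β)},
    l₁.Pairwise (fun e e' => e'.2 ≤ e.2) → l₂.Pairwise (fun e e' => e'.2 ≤ e.2) →
    (∀ e ∈ l₁, e.2 ∈ B) → (∀ e ∈ l₂, e.2 ∉ B) →
    ∃ l : List (β × β), l.Pairwise (fun e e' => e'.2 ≤ e.2) ∧ (∀ e ∈ l, e ∈ l₁ ∨ e ∈ l₂) ∧
      l.filter (·.2 ∈ B) = l₁ ∧ l.filter (·.2 ∉ B) = l₂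
  | [], l₂, _, h2, _, h4 => by
    refine ⟨l₂, h2, fun e he => Or.inr he, ?_, ?_⟩
    · simpa using fun a b h => h4 (a, b) h
    · simpa using fun a b h => h4 (a, b) h
  | e :: l₁, [], h1, _, h3, _ => by
    refine ⟨e :: l₁, h1, fun e he => Or.inl he, ?_, ?_⟩
    · simpa only [List.filter_eq_self, decide_eq_true_eq] using h3
    · simpa only [List.filter_eq_nil_iff, decide_eq_true_eq, not_not] using h3
  | e :: l₁, e' :: l₂, h1, h2, h3, h4 => by
    have k1 := List.pairwise_cons.1 h1
    have k2 := List.pairwise_cons.1 h2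
    have k3 := List.forall_mem_cons.1 h3
    have k4 := List.forall_mem_cons.1 h4
    rcases le_total e'.2 e.2 with hle | hle
    · obtain ⟨l, hl, hmem, hf1, hf2⟩ := exists_shuffle k1.2 h2 k3.2 h4
      refine ⟨e :: l, List.pairwise_cons.2 ⟨fun x hx => ?_, hl⟩, fun x hx => ?_, ?_, ?_⟩
      · rcases hmem x hx with h | h
        · exact k1.1 x h
        · rcases List.mem_cons.1 h with rfl | h
          · exact hle
          · exact (k2.1 x h).trans hle
      · rcases List.mem_cons.1 hx with rfl | h
        · simp
        · rcases hmem x h with h | h <;> simp [h]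
      · rw [List.filter_cons_of_pos (by simpa using k3.1), hf1]
      · rw [List.filter_cons_of_neg (by simpa using k3.1), hf2]
    · obtain ⟨l, hl, hmem, hf1, hf2⟩ := exists_shuffle h1 k2.2 h3 k4.2
      refine ⟨e' :: l, List.pairwise_cons.2 ⟨fun x hx => ?_, hl⟩, fun x hx => ?_, ?_, ?_⟩
      · rcases hmem x hx with h | h
        · rcases List.mem_cons.1 h with rfl | h
          · exact hle
          · exact (k1.1 x h).trans hle
        · exact k2.1 x h
      · rcases List.mem_cons.1 hx with rfl | h
        · simp
        · rcases hmem x h with h | h <;> simp [h]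
      · rw [List.filter_cons_of_neg (by simpa using k4.1), hf1]
      · rw [List.filter_cons_of_pos (by simpa using k4.1), hf2]

/-- A set closed for the edges inside `B` is closed for all edges, if `B` is closed. -/
theorem IsSaturated.of_filter {l : List (β × β)} {B C : Finset β} (hB : IsSaturated l B) (hC : C ⊆ B)
    (h : IsSaturated (l.filter (·.2 ∈ B)) C) : IsSaturated l C := by
  intro e he
  by_cases heB : e.2 ∈ B
  · exact h e (List.mem_filter.2 ⟨he, by simpa using heB⟩)
  · exact ⟨fun h1 => absurd ((hB e he).1 (hC h1)) heB, fun h2 => absurd (hC h2) heB⟩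

theorem IsSaturated.union {l : List (β × β)} {B C : Finset β} (hB : IsSaturated l B)
    (hC : IsSaturated l C) : IsSaturated l (B ∪ C) := by
  intro e he
  rw [mem_union, mem_union, hB e he, hC e he]

theorem IsSaturated.inter {l : List (β × β)} {B C : Finset β} (hB : IsSaturated l B)
    (hC : IsSaturated l C) : IsSaturated l (B ∩ C) := by
  intro e he
  rw [mem_inter, mem_inter, hB e he, hC e he]

theorem isConn_filter_of_isConn_cons {A B : Finset β} {l : List (β × β)} (hl : IsMonotoneList A l)
    (hBA : B ⊆ A) {e : β × β} (hA : e.1 ∈ A ∧ e.2 ∈ A) (he : ¬ (e.1 ∈ B ↔ e.2 ∈ B))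
    (hB : IsSaturated l B) (h : IsConn A (e :: l)) : IsConn B (l.filter (·.2 ∈ B)) := by
  intro C hCB hne hC
  have hCl := hB.of_filter hCB hC
  by_cases hCe : e.1 ∈ C ↔ e.2 ∈ C
  · have hCA := h C (hCB.trans hBA) hne (isSaturated_cons.2 ⟨hCe, hCl⟩)
    exact absurd (hCB.antisymm (hCA ▸ hBA)) fun hh => he (hh ▸ hCe)
  · have hU := h (C ∪ A \ B) (union_subset (hCB.trans hBA) sdiff_subset)
      (hne.mono subset_union_left)
      (isSaturated_cons.2 ⟨by
        have h1 := @hCB e.1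
        have h2 := @hCB e.2
        simp only [mem_union, mem_sdiff, hA.1, hA.2, true_and]
        tauto, hCl.union (hl.isSaturated_sdiff hB)⟩)
    refine hCB.antisymm fun x hx => ?_
    have := hU ▸ hBA hx
    simpa [hx] using this

theorem isConn_cons_iff {A B : Finset β} {l : List (β × β)} (hl : IsMonotoneList A l)
    (hBA : B ⊆ A) {e : β × β} (hA : e.1 ∈ A ∧ e.2 ∈ A) (he : e.1 ∉ B ∧ e.2 ∈ B)
    (hB : IsSaturated l B) :
    IsConn A (e :: l) ↔
      IsConn B (l.filter (·.2 ∈ B)) ∧ IsConn (A \ B) (l.filter (·.2 ∉ B)) := by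
  rw [hl.filter_notMem]
  constructor
  · intro h
    refine ⟨isConn_filter_of_isConn_cons hl hBA hA (by tauto) hB h,
      isConn_filter_of_isConn_cons hl sdiff_subset hA ?_ (hl.isSaturated_sdiff hB) h⟩
    simp only [mem_sdiff, hA.1, hA.2, true_and]
    tauto
  · rintro ⟨h1, h2⟩ D hDA hne hD
    rw [isSaturated_cons] at hD
    have k1 := h1 (D ∩ B) inter_subset_right
    have k2 := h2 (D ∩ (A \ B)) inter_subset_right
    have c1 := fun hh => k1 hh ((hD.2.inter hB).filter _)
    have c2 := fun hh => k2 hh ((hD.2.inter (hl.isSaturated_sdiff hB)).filter _)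
    have hD2 : e.2 ∈ D := by
      obtain ⟨x, hx⟩ := hne
      by_cases hxB : x ∈ B
      · have := c1 ⟨x, mem_inter.2 ⟨hx, hxB⟩⟩
        exact (mem_inter.1 (this.symm ▸ he.2 : e.2 ∈ D ∩ B)).1
      · have := c2 ⟨x, mem_inter.2 ⟨hx, mem_sdiff.2 ⟨hDA hx, hxB⟩⟩⟩
        have h3 : e.1 ∈ D ∩ (A \ B) := by
          rw [this]
          exact mem_sdiff.2 ⟨hA.1, he.1⟩
        exact hD.1.1 (mem_inter.1 h3).1
    have e1 := c1 ⟨e.2, mem_inter.2 ⟨hD2, he.2⟩⟩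
    have e2 := c2 ⟨e.1, mem_inter.2 ⟨hD.1.2 hD2, mem_sdiff.2 ⟨hA.1, he.1⟩⟩⟩
    refine hDA.antisymm fun x hx => ?_
    by_cases hxB : x ∈ B
    · exact (mem_inter.1 (e1.symm ▸ hxB : x ∈ D ∩ B)).1
    · have h3 : x ∈ D ∩ (A \ B) := by
        rw [e2]
        exact mem_sdiff.2 ⟨hx, hxB⟩
      exact (mem_inter.1 h3).1

theorem exists_isSaturated_of_not_isConn {A : Finset β} {l : List (β × β)}
    (hl : IsMonotoneList A l) {e : β × β} (hA : e.1 ∈ A ∧ e.2 ∈ A) (h : IsConn A (e :: l))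
    (h' : ¬ IsConn A l) : ∃ B ⊆ A, e.1 ∉ B ∧ e.2 ∈ B ∧ IsSaturated l B := by
  simp only [IsConn, not_forall] at h'
  obtain ⟨C, hCA, hne, hC, hCne⟩ := h'
  have hce : ¬ (e.1 ∈ C ↔ e.2 ∈ C) := fun hh => hCne (h C hCA hne (isSaturated_cons.2 ⟨hh, hC⟩))
  by_cases h2 : e.2 ∈ C
  · exact ⟨C, hCA, by tauto, h2, hC⟩
  · exact ⟨A \ C, sdiff_subset, by rw [mem_sdiff]; tauto, by rw [mem_sdiff]; tauto,
      hl.isSaturated_sdiff hC⟩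

theorem swap_apply_mem {A : Finset β} {s n a : β} (hs : s ∈ A) (hn : n ∈ A) (ha : a ∈ A) :
    swap s n a ∈ A := by
  rw [swap_apply_def]
  split_ifs
  exacts [hn, hs, ha]

theorem swapProd_cons_agree {A : Finset β} {σ : Perm β} {s n : β} (hs : s ∈ A) (hn : n ∈ A)
    (l : List (β × β)) : (∀ a ∈ A, swapProd ((s, n) :: l) a = σ a) ↔
      ∀ a ∈ A, swapProd l a = (σ * swap s n) a := by
  simp_rw [swapProd_cons, Perm.mul_apply]
  constructor
  · intro h a ha
    simpa using h _ (swap_apply_mem hs hn ha)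
  · intro h a ha
    simpa using h _ (swap_apply_mem hs hn ha)

variable [Fintype β]

open Classical in
/-- The transitive monotone factorizations on `A`, with `m` factors, of the permutation which
`σ` induces on `A`. -/
noncomputable def factorizations (m : ℕ) (A : Finset β) (σ : Perm β) : Finset (List (β × β)) :=
  (List.finite_length_eq (β × β) m).toFinset.filter fun l =>
    IsMonotoneList A l ∧ (∀ a ∈ A, swapProd l a = σ a) ∧ IsConn A l

theorem mem_factorizations {m : ℕ} {A : Finset β} {σ : Perm β} {l : List (β × β)} :
    l ∈ factorizations m A σ ↔
      l.length = m ∧ IsMonotoneList A l ∧ (∀ a ∈ A, swapProd l a = σ a) ∧ IsConn A l := by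
  simp [factorizations]

theorem apply_mem_of_factorizations_nonempty {m : ℕ} {A : Finset β} {σ : Perm β}
    (h : (factorizations m A σ).Nonempty) {a : β} (ha : a ∈ A) : σ a ∈ A := by
  obtain ⟨l, hl⟩ := h
  rw [mem_factorizations] at hl
  rw [← hl.2.2.1 a ha]
  exact (swapProd_apply_filter hl.2.1.isSaturated ha).1

theorem cons_mem_factorizations {m : ℕ} {A : Finset β} {σ : Perm β} {n s : β} (hn : n ∈ A)
    (hmax : ∀ a ∈ A, a ≤ n) (hs : s ∈ A.erase n) {l : List (β × β)} :
    (s, n) :: l ∈ factorizations (m + 1) A σ ↔ l.length = m ∧ IsMonotoneList A l ∧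
      (∀ a ∈ A, swapProd l a = (σ * swap s n) a) ∧ IsConn A ((s, n) :: l) := by
  rw [mem_factorizations, isMonotoneList_cons hn hmax hs,
    swapProd_cons_agree (mem_of_mem_erase hs) hn, List.length_cons, Nat.add_right_cancel_iff]

theorem exists_of_mem_factorizations_succ {m : ℕ} {A : Finset β} {σ : Perm β} {n : β} (hn : n ∈ A)
    (hmax : ∀ a ∈ A, a ≤ n) (hA : A ≠ {n}) {l : List (β × β)}
    (hl : l ∈ factorizations (m + 1) A σ) : ∃ s ∈ A.erase n, ∃ l', l = (s, n) :: l' := by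
  rw [mem_factorizations] at hl
  obtain ⟨hlen, hm, -, hc⟩ := hl
  cases l with
  | nil => simp at hlen
  | cons e l =>
    obtain ⟨s, t⟩ := e
    have h1 : s < t := hm.lt (s, t) (by simp)
    have h2 : s ∈ A := hm.fst_mem (s, t) (by simp)
    suffices ht : t = n by
      subst ht
      exact ⟨s, mem_erase.2 ⟨h1.ne, h2⟩, l, rfl⟩
    by_contra ht
    refine hA (hc {n} (by simpa using hn) (singleton_nonempty n) fun e he => ?_).symm
    have h3 : e.2 ≤ t := by
      rcases List.mem_cons.1 he with rfl | he
      · exact le_rfl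
      · exact (List.pairwise_cons.1 hm.pairwise).1 e he
    have h4 : e.2 < n := h3.trans_lt (lt_of_le_of_ne (hmax t (hm.snd_mem (s, t) (by simp))) ht)
    have h5 := hm.lt e he
    simp only [mem_singleton]
    exact ⟨fun h => absurd (h ▸ h5) h4.not_gt, fun h => absurd h h4.ne⟩

open Classical in
/-- Transitive monotone factorizations on `B` and on `A \ B`, shuffled into a single list. -/
noncomputable def splitFactorizations (m : ℕ) (A B : Finset β) (σ : Perm β) :
    Finset (List (β × β)) :=
  (List.finite_length_eq (β × β) m).toFinset.filter fun l =>
    IsMonotoneList A l ∧ (∀ a ∈ A, swapProd l a = σ a) ∧ IsSaturated l B ∧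
      IsConn B (l.filter (·.2 ∈ B)) ∧ IsConn (A \ B) (l.filter (·.2 ∉ B))

theorem mem_splitFactorizations {m : ℕ} {A B : Finset β} {σ : Perm β} {l : List (β × β)} :
    l ∈ splitFactorizations m A B σ ↔
      l.length = m ∧ IsMonotoneList A l ∧ (∀ a ∈ A, swapProd l a = σ a) ∧ IsSaturated l B ∧
      IsConn B (l.filter (·.2 ∈ B)) ∧ IsConn (A \ B) (l.filter (·.2 ∉ B)) := by
  simp [splitFactorizations]

theorem card_splitFactorizations (m : ℕ) {A B : Finset β} (hBA : B ⊆ A) (σ : Perm β) :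
    #(splitFactorizations m A B σ) = ∑ p ∈ antidiagonal m,
      #(factorizations p.1 B σ) * #(factorizations p.2 (A \ B) σ) := by
  simp_rw [← card_product]
  rw [← card_sigma]
  refine card_bij (fun l _ => ⟨((l.filter (·.2 ∈ B)).length, (l.filter (·.2 ∉ B)).length),
    (l.filter (·.2 ∈ B), l.filter (·.2 ∉ B))⟩) ?_ ?_ ?_
  · intro l hl
    rw [mem_splitFactorizations] at hl
    obtain ⟨hlen, hm, hσ, hB, h1, h2⟩ := hl
    have hAB := hm.isSaturated_sdiff hB
    rw [mem_sigma, mem_product, mem_factorizations, mem_factorizations,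
      HasAntidiagonal.mem_antidiagonal]
    refine ⟨?_, ⟨rfl, hm.filter hB, fun a ha => ?_, h1⟩, rfl, ?_, fun a ha => ?_, h2⟩
    · have := List.length_eq_length_filter_add (l := l) (fun e => decide (e.2 ∈ B))
      simp only [← decide_not] at this
      exact this.symm.trans hlen
    · rw [(swapProd_apply_filter hB ha).2, hσ a (hBA ha)]
    · rw [hm.filter_notMem]
      exact hm.filter hAB
    · rw [hm.filter_notMem, (swapProd_apply_filter hAB ha).2, hσ a (mem_sdiff.1 ha).1]
  · intro l hl l' hl' h
    rw [mem_splitFactorizations] at hl hl'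
    rw [Sigma.mk.injEq] at h
    have h2 := Prod.mk.injEq .. ▸ eq_of_heq h.2
    exact eq_of_filter_eq hl.2.1.pairwise hl'.2.1.pairwise h2.1 h2.2
  · rintro ⟨⟨i, j⟩, l₁, l₂⟩ h
    rw [mem_sigma, mem_product, mem_factorizations, mem_factorizations,
      HasAntidiagonal.mem_antidiagonal] at h
    dsimp only at h
    obtain ⟨hij, ⟨rfl, hm₁, hσ₁, hc₁⟩, rfl, hm₂, hσ₂, hc₂⟩ := h
    obtain ⟨l, hl, hmem, hf₁, hf₂⟩ := exists_shuffle hm₁.pairwise hm₂.pairwise hm₁.snd_mem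
      fun e he => (mem_sdiff.1 (hm₂.snd_mem e he)).2
    have hm : IsMonotoneList A l := by
      refine ⟨fun e he => ?_, fun e he => ?_, fun e he => ?_, hl⟩
      · exact (hmem e he).elim (hm₁.lt e) (hm₂.lt e)
      · exact (hmem e he).elim (fun h => hBA (hm₁.fst_mem e h))
          fun h => (mem_sdiff.1 (hm₂.fst_mem e h)).1
      · exact (hmem e he).elim (fun h => hBA (hm₁.snd_mem e h))
          fun h => (mem_sdiff.1 (hm₂.snd_mem e h)).1
    have hB : IsSaturated l B := by
      intro e he
      rcases hmem e he with h | h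
      · exact iff_of_true (hm₁.fst_mem e h) (hm₁.snd_mem e h)
      · exact iff_of_false (mem_sdiff.1 (hm₂.fst_mem e h)).2 (mem_sdiff.1 (hm₂.snd_mem e h)).2
    refine ⟨l, mem_splitFactorizations.2 ⟨?_, hm, fun a ha => ?_, hB, ?_, ?_⟩, ?_⟩
    · have := List.length_eq_length_filter_add (l := l) (fun e => decide (e.2 ∈ B))
      simp only [← decide_not] at this
      rw [hf₁, hf₂] at this
      exact this.trans hij
    · by_cases haB : a ∈ B
      · rw [← (swapProd_apply_filter hB haB).2, hf₁, hσ₁ a haB]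
      · have haB' := mem_sdiff.2 ⟨ha, haB⟩
        rw [← (swapProd_apply_filter (hm.isSaturated_sdiff hB) haB').2, ← hm.filter_notMem, hf₂,
          hσ₂ a haB']
    · rwa [hf₁]
    · rwa [hf₂]
    · rw [hf₁, hf₂]

theorem splitFactorizations_disjoint {m : ℕ} {A B C : Finset β} {σ : Perm β} {n : β} (hB : n ∈ B)
    (hC : n ∈ C) {l : List (β × β)} (hlB : l ∈ splitFactorizations m A B σ)
    (hlC : l ∈ splitFactorizations m A C σ) : B = C := by
  rw [mem_splitFactorizations] at hlB hlC
  have hI := hlB.2.2.2.1.inter hlC.2.2.2.1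
  have h1 := hlB.2.2.2.2.1 (B ∩ C) inter_subset_left ⟨n, mem_inter.2 ⟨hB, hC⟩⟩ (hI.filter _)
  have h2 := hlC.2.2.2.2.1 (B ∩ C) inter_subset_right ⟨n, mem_inter.2 ⟨hB, hC⟩⟩ (hI.filter _)
  exact h1.symm.trans h2

theorem card_factorizations_succ (m : ℕ) {A : Finset β} (σ : Perm β) {n : β} (hn : n ∈ A)
    (hmax : ∀ a ∈ A, a ≤ n) (hA : A ≠ {n}) :
    #(factorizations (m + 1) A σ) = ∑ s ∈ A.erase n, (#(factorizations m A (σ * swap s n)) +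
      ∑ B ∈ (A.erase s).powerset.filter (n ∈ ·), ∑ p ∈ antidiagonal m,
        #(factorizations p.1 B (σ * swap s n)) *
          #(factorizations p.2 (A \ B) (σ * swap s n))) := by
  classical
  have h1 : factorizations (m + 1) A σ = (A.erase n).biUnion fun s =>
      ((factorizations m A (σ * swap s n)) ∪ ((A.erase s).powerset.filter (n ∈ ·)).biUnion
        fun B => splitFactorizations m A B (σ * swap s n)).image (List.cons (s, n)) := by
    ext l
    simp only [mem_biUnion, mem_image, mem_union, mem_filter, mem_powerset]
    constructor
    · intro hl
      obtain ⟨s, hs, l, rfl⟩ := exists_of_mem_factorizations_succ hn hmax hA hl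
      rw [cons_mem_factorizations hn hmax hs] at hl
      refine ⟨s, hs, l, ?_, rfl⟩
      obtain ⟨hlen, hm, hσ, hc⟩ := hl
      by_cases hc' : IsConn A l
      · exact Or.inl (mem_factorizations.2 ⟨hlen, hm, hσ, hc'⟩)
      · have hsA : (s, n).1 ∈ A ∧ (s, n).2 ∈ A := ⟨mem_of_mem_erase hs, hn⟩
        obtain ⟨B, hBA, hsB, hnB, hB⟩ := exists_isSaturated_of_not_isConn hm hsA hc hc'
        exact Or.inr ⟨B, ⟨subset_erase.2 ⟨hBA, hsB⟩, hnB⟩, mem_splitFactorizations.2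
          ⟨hlen, hm, hσ, hB, (isConn_cons_iff hm hBA hsA ⟨hsB, hnB⟩ hB).1 hc⟩⟩
    · rintro ⟨s, hs, l, hl, rfl⟩
      rw [cons_mem_factorizations hn hmax hs]
      rcases hl with hl | ⟨B, ⟨hBA, hnB⟩, hl⟩
      · rw [mem_factorizations] at hl
        exact ⟨hl.1, hl.2.1, hl.2.2.1, hl.2.2.2.cons _⟩
      · rw [mem_splitFactorizations] at hl
        obtain ⟨hlen, hm, hσ, hB, hc⟩ := hl
        rw [subset_erase] at hBA
        exact ⟨hlen, hm, hσ, (isConn_cons_iff hm hBA.1 ⟨mem_of_mem_erase hs, hn⟩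
          ⟨hBA.2, hnB⟩ hB).2 hc⟩
  rw [h1, card_biUnion]
  · refine sum_congr rfl fun s hs => ?_
    rw [card_image_of_injective _ List.cons_injective, card_union_of_disjoint, card_biUnion]
    · congr 1
      refine sum_congr rfl fun B hB => ?_
      rw [mem_filter, mem_powerset, subset_erase] at hB
      rw [card_splitFactorizations m hB.1.1]
    · intro B hB C hC hBC
      rw [Function.onFun, Finset.disjoint_left]
      intro l hl hl'
      exact hBC (splitFactorizations_disjoint (mem_filter.1 hB).2 (mem_filter.1 hC).2 hl hl')
    · rw [Finset.disjoint_left]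
      intro l hl hl'
      obtain ⟨B, hB, hl'⟩ := mem_biUnion.1 hl'
      rw [mem_filter, mem_powerset, subset_erase] at hB
      rw [mem_factorizations] at hl
      rw [mem_splitFactorizations] at hl'
      have := hl.2.2.2 B hB.1.1 ⟨n, hB.2⟩ hl'.2.2.2.1
      exact hB.1.2 (this ▸ mem_of_mem_erase hs)
  · intro s _ s' _ hss
    rw [Function.onFun, Finset.disjoint_left]
    intro l hl hl'
    obtain ⟨l₁, -, rfl⟩ := mem_image.1 hl
    obtain ⟨l₂, -, h⟩ := mem_image.1 hl'
    rw [List.cons.injEq, Prod.mk.injEq] at h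
    exact hss h.1.1.symm

end Factorizations

/-! ### Orbits of a permutation multiplied by a transposition -/

section Orbits

open Equiv Function

variable {β : Type*}

/-- `O` is an orbit of `σ`. -/
structure IsOrbit (σ : Perm β) (O : Finset β) : Prop where
  nonempty : O.Nonempty
  mem_iff : ∀ x ∈ O, ∀ y, y ∈ O ↔ σ.SameCycle x y

theorem IsOrbit.eq {σ : Perm β} {O O' : Finset β} (h : IsOrbit σ O) (h' : IsOrbit σ O') {x : β}
    (hx : x ∈ O) (hx' : x ∈ O') : O = O' := by
  ext y
  rw [h.mem_iff x hx, h'.mem_iff x hx']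

theorem IsOrbit.apply_mem {σ : Perm β} {O : Finset β} (h : IsOrbit σ O) {x : β} (hx : x ∈ O) :
    σ x ∈ O :=
  (h.mem_iff x hx _).2 (Perm.sameCycle_apply_right.2 (Perm.SameCycle.refl σ x))

theorem SameCycle.exists_iterate [Finite β] {σ : Perm β} {x y : β} (h : σ.SameCycle x y) :
    ∃ i : ℕ, σ^[i] x = y := by
  obtain ⟨i, -, hi⟩ := h.exists_pow_eq'
  exact ⟨i, by rw [Perm.iterate_eq_pow, hi]⟩

theorem sameCycle_iterate (σ : Perm β) (x : β) (i : ℕ) : σ.SameCycle x (σ^[i] x) :=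
  ⟨i, by rw [Perm.iterate_eq_pow, zpow_natCast]⟩

theorem SameCycle.mem_of_mapsTo [Finite β] {σ : Perm β} {O : Finset β} (h : ∀ x ∈ O, σ x ∈ O)
    {x y : β} (hx : x ∈ O) (hxy : σ.SameCycle x y) : y ∈ O := by
  obtain ⟨i, rfl⟩ := SameCycle.exists_iterate hxy
  induction i with
  | zero => exact hx
  | succ i ih =>
    rw [iterate_succ_apply']
    exact h _ (ih (sameCycle_iterate σ x i))

theorem SameCycle.of_apply [Finite β] {σ τ : Perm β} (h : ∀ x, τ.SameCycle x (σ x)) {x y : β}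
    (hxy : σ.SameCycle x y) : τ.SameCycle x y := by
  obtain ⟨i, rfl⟩ := SameCycle.exists_iterate hxy
  clear hxy
  induction i with
  | zero => exact Perm.SameCycle.refl τ x
  | succ i ih =>
    rw [iterate_succ_apply']
    exact ih.trans (h _)

theorem IsOrbit.of_mapsTo [Finite β] {σ : Perm β} {O : Finset β} {x : β} (hx : x ∈ O)
    (h : ∀ y ∈ O, σ y ∈ O) (h' : ∀ y ∈ O, σ.SameCycle x y) : IsOrbit σ O :=
  ⟨⟨x, hx⟩, fun y hy z => ⟨fun hz => (h' y hy).symm.trans (h' z hz),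
    fun hz => SameCycle.mem_of_mapsTo h hy hz⟩⟩

theorem IsOrbit.congr [Finite β] {σ τ : Perm β} {O : Finset β} (h : IsOrbit σ O)
    (hτ : ∀ x ∈ O, τ x = σ x) : IsOrbit τ O := by
  obtain ⟨x, hx⟩ := h.nonempty
  refine IsOrbit.of_mapsTo hx (fun y hy => hτ y hy ▸ h.apply_mem hy) fun y hy => ?_
  obtain ⟨i, rfl⟩ := SameCycle.exists_iterate ((h.mem_iff x hx y).1 hy)
  clear hy
  induction i with
  | zero => exact Perm.SameCycle.refl τ x
  | succ i ih =>
    rw [iterate_succ_apply', ← hτ _ ((h.mem_iff x hx _).2 (sameCycle_iterate σ x i))]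
    exact Perm.sameCycle_apply_right.2 ih

theorem minimalPeriod_perm_pos [Finite β] (σ : Perm β) (x : β) : 0 < minimalPeriod σ x := by
  refine minimalPeriod_pos_of_mem_periodicPts ?_
  have hpos := orderOf_pos σ
  refine ⟨orderOf σ, hpos, ?_⟩
  rw [IsPeriodicPt, IsFixedPt, Perm.iterate_eq_pow, pow_orderOf_eq_one, Perm.one_apply]

theorem iterate_injOn_range (σ : Perm β) (x : β) :
    Set.InjOn (fun i => σ^[i] x) (range (minimalPeriod σ x)) := by
  intro i hi j hj hij
  rw [coe_range, Set.mem_Iio] at hi hj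
  exact iterate_injOn_Iio_minimalPeriod hi hj hij

theorem pairwiseDisjoint_of_isOrbit {σ : Perm β} {Q : Finset (Finset β)}
    (hQ : ∀ O ∈ Q, IsOrbit σ O) : (Q : Set (Finset β)).PairwiseDisjoint id := by
  intro O hO O' hO' hne
  rw [Function.onFun, Finset.disjoint_left]
  intro x hx hx'
  exact hne ((hQ O hO).eq (hQ O' hO') hx hx')

variable [DecidableEq β]

theorem IsOrbit.eq_image [Finite β] {σ : Perm β} {O : Finset β} (h : IsOrbit σ O) {x : β}
    (hx : x ∈ O) : O = (range (minimalPeriod σ x)).image fun i => σ^[i] x := by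
  ext y
  rw [h.mem_iff x hx, mem_image]
  constructor
  · intro hy
    obtain ⟨i, rfl⟩ := SameCycle.exists_iterate hy
    exact ⟨i % minimalPeriod σ x, mem_range.2 (Nat.mod_lt _ (minimalPeriod_perm_pos σ x)),
      iterate_mod_minimalPeriod_eq⟩
  · rintro ⟨i, -, rfl⟩
    exact sameCycle_iterate σ x i

theorem IsOrbit.card_eq [Finite β] {σ : Perm β} {O : Finset β} (h : IsOrbit σ O) {x : β}
    (hx : x ∈ O) : #O = minimalPeriod σ x := by
  conv_lhs => rw [h.eq_image hx]
  rw [card_image_of_injOn (iterate_injOn_range σ x), card_range]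

theorem iterate_mul_swap {σ : Perm β} {s n : β} {p : ℕ}
    (h : ∀ j, 0 < j → j < p → σ^[j] s ≠ s ∧ σ^[j] s ≠ n) {j : ℕ} (hj : 0 < j) (hjp : j ≤ p) :
    (σ * swap s n)^[j] n = σ^[j] s := by
  induction j, hj using Nat.le_induction with
  | base => simp
  | succ j hj ih =>
    have := h j hj hjp
    rw [iterate_succ_apply', ih (by omega), Perm.mul_apply, swap_apply_of_ne_of_ne this.1 this.2,
      iterate_succ_apply']

theorem sameCycle_mul_swap [Finite β] {σ : Perm β} {s n : β} (h : ¬ σ.SameCycle s n) :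
    (σ * swap s n).SameCycle n s := by
  have h1 := iterate_mul_swap (σ := σ) (s := s) (n := n) (p := minimalPeriod σ s)
    (fun j hj hjp => ⟨fun he => ?_, fun he => h (he ▸ sameCycle_iterate σ s j)⟩)
    (minimalPeriod_perm_pos σ s) le_rfl
  · rw [iterate_minimalPeriod] at h1
    have h2 := sameCycle_iterate (σ * swap s n) n (minimalPeriod σ s)
    rwa [h1] at h2
  · exact not_isPeriodicPt_of_pos_of_lt_minimalPeriod hj.ne' hjp he

theorem IsOrbit.mul_swap_of_notMem [Finite β] {σ : Perm β} {O : Finset β} (h : IsOrbit σ O)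
    {s n : β} (hs : s ∉ O) (hn : n ∉ O) : IsOrbit (σ * swap s n) O := by
  refine h.congr fun x hx => ?_
  rw [Perm.mul_apply, swap_apply_of_ne_of_ne (by rintro rfl; exact hs hx)
    (by rintro rfl; exact hn hx)]

theorem mul_swap_apply_mem {σ : Perm β} {O : Finset β} (h : ∀ x ∈ O, σ x ∈ O) {s n : β}
    (hs : s ∈ O) (hn : n ∈ O) {x : β} (hx : x ∈ O) : (σ * swap s n) x ∈ O := by
  rw [Perm.mul_apply, swap_apply_def]
  split_ifs
  exacts [h _ hn, h _ hs, h _ hx]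

theorem IsOrbit.join [Finite β] {σ : Perm β} {K C : Finset β} (hK : IsOrbit σ K)
    (hC : IsOrbit σ C) (hKC : K ≠ C) {s n : β} (hn : n ∈ K) (hs : s ∈ C) :
    IsOrbit (σ * swap s n) (K ∪ C) := by
  have hsn : ¬ σ.SameCycle s n := fun h => hKC (hK.eq hC hn ((hC.mem_iff s hs n).2 h))
  have h1 := sameCycle_mul_swap hsn
  have h2 : ∀ x, (σ * swap s n).SameCycle x (σ x) := by
    intro x
    by_cases hxs : x = s
    · subst hxs
      have : (σ * swap x n) n = σ x := by simp
      rw [← this, Perm.sameCycle_apply_right]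
      exact h1.symm
    · by_cases hxn : x = n
      · subst hxn
        have : (σ * swap s x) s = σ x := by simp
        rw [← this, Perm.sameCycle_apply_right]
        exact h1
      · have : (σ * swap s n) x = σ x := by
          rw [Perm.mul_apply, swap_apply_of_ne_of_ne hxs hxn]
        rw [← this, Perm.sameCycle_apply_right]
  refine IsOrbit.of_mapsTo (mem_union_left C hn) (fun y hy => mul_swap_apply_mem
    (fun x hx => ?_) (mem_union_right K hs) (mem_union_left C hn) hy) fun y hy => ?_
  · rcases mem_union.1 hx with hx | hx
    · exact mem_union_left C (hK.apply_mem hx)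
    · exact mem_union_right K (hC.apply_mem hx)
  · rcases mem_union.1 hy with hy | hy
    · exact SameCycle.of_apply h2 ((hK.mem_iff n hn y).1 hy)
    · exact h1.trans (SameCycle.of_apply h2 ((hC.mem_iff s hs y).1 hy))

theorem minimalPeriod_mul_swap [Finite β] {σ : Perm β} {n : β} {i : ℕ} (hi : 0 < i)
    (hik : i < minimalPeriod σ n) :
    minimalPeriod (σ * swap (σ^[i] n) n) n = minimalPeriod σ n - i ∧
      ¬ (σ * swap (σ^[i] n) n).SameCycle n (σ^[i] n) := by
  set k := minimalPeriod σ n with hk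
  have hinj : ∀ a < k, ∀ b < k, σ^[a] n = σ^[b] n → a = b := fun a ha b hb hab =>
    iterate_injOn_Iio_minimalPeriod (f := σ) (x := n) ha hb hab
  have hit : ∀ j, 0 < j → j ≤ k - i → (σ * swap (σ^[i] n) n)^[j] n = σ^[j + i] n := by
    intro j hj hjk
    rw [iterate_mul_swap (p := k - i) (fun j hj hjk => ?_) hj hjk, iterate_add_apply]
    rw [← iterate_add_apply]
    refine ⟨fun h => ?_, fun h => ?_⟩
    · have := hinj _ (by omega) _ (by omega) h
      omega
    · have := hinj _ (by omega) 0 (by omega) h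
      omega
  have hper : IsPeriodicPt (σ * swap (σ^[i] n) n) (k - i) n := by
    rw [IsPeriodicPt, IsFixedPt, hit _ (by omega) le_rfl, Nat.sub_add_cancel hik.le, hk,
      iterate_minimalPeriod]
  have hmin : minimalPeriod (σ * swap (σ^[i] n) n) n = k - i := by
    refine le_antisymm (hper.minimalPeriod_le (by omega)) ?_
    by_contra! hlt
    have hpos := minimalPeriod_perm_pos (σ * swap (σ^[i] n) n) n
    have h1 := hit _ hpos hlt.le
    rw [iterate_minimalPeriod] at h1
    have := hinj 0 (by omega) _ (by omega) h1
    omega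
  refine ⟨hmin, fun h => ?_⟩
  obtain ⟨j, hj⟩ := SameCycle.exists_iterate h
  rw [← iterate_mod_minimalPeriod_eq, hmin] at hj
  have hlt := Nat.mod_lt j (show k - i > 0 by omega)
  rcases Nat.eq_zero_or_pos (j % (k - i)) with h0 | h0
  · rw [h0] at hj
    have := hinj 0 (by omega) i hik hj
    omega
  · rw [hit _ h0 hlt.le] at hj
    have := hinj _ (by omega) i hik hj
    omega

theorem IsOrbit.exists_cut [Fintype β] {σ : Perm β} {K : Finset β} (hK : IsOrbit σ K) {n : β}
    (hn : n ∈ K) {i : ℕ} (hi : 0 < i) (hik : i < #K) :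
    ∃ K₁ K₂ : Finset β, IsOrbit (σ * swap (σ^[i] n) n) K₁ ∧ IsOrbit (σ * swap (σ^[i] n) n) K₂ ∧
      n ∈ K₁ ∧ σ^[i] n ∈ K₂ ∧ Disjoint K₁ K₂ ∧ K₁ ∪ K₂ = K ∧ #K₁ = #K - i ∧ #K₂ = i := by
  classical
  have hk := hK.card_eq hn
  have hs : σ^[i] n ∈ K := (hK.mem_iff n hn _).2 (sameCycle_iterate σ n i)
  obtain ⟨h1, h2⟩ := minimalPeriod_mul_swap hi (hk ▸ hik)
  have horb : ∀ (τ : Perm β) (x : β), IsOrbit τ (univ.filter fun y => τ.SameCycle x y) := by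
    intro τ x
    refine IsOrbit.of_mapsTo (x := x) (by simp [Perm.SameCycle.refl]) (fun y hy => ?_)
      fun y hy => (mem_filter.1 hy).2
    rw [mem_filter] at hy ⊢
    exact ⟨mem_univ _, Perm.sameCycle_apply_right.2 hy.2⟩
  have hks := hK.card_eq hs
  have h3 : minimalPeriod (σ * swap (σ^[i] n) n) (σ^[i] n) = i := by
    have hback : σ^[#K - i] (σ^[i] n) = n := by
      rw [← iterate_add_apply, Nat.sub_add_cancel hik.le, hk, iterate_minimalPeriod]
    have := (minimalPeriod_mul_swap (σ := σ) (n := σ^[i] n) (i := #K - i) (by omega)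
      (by omega)).1
    rw [hback, swap_comm, ← hks] at this
    omega
  set s := σ^[i] n with hsdef
  set τ := σ * swap s n with hτ
  have hKτ : ∀ x ∈ K, τ x ∈ K := fun x hx =>
    mul_swap_apply_mem (fun y hy => hK.apply_mem hy) hs hn hx
  have hn1 : n ∈ univ.filter fun y => τ.SameCycle n y := by simp [Perm.SameCycle.refl]
  have hs2 : s ∈ univ.filter fun y => τ.SameCycle s y := by simp [Perm.SameCycle.refl]
  have hd : Disjoint (univ.filter fun y => τ.SameCycle n y)
      (univ.filter fun y => τ.SameCycle s y) := by
    rw [Finset.disjoint_left]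
    intro x hx hx'
    rw [mem_filter] at hx hx'
    exact h2 (hx.2.trans hx'.2.symm)
  have hc1 := (horb τ n).card_eq hn1
  have hc2 := (horb τ s).card_eq hs2
  refine ⟨_, _, horb τ n, horb τ s, hn1, hs2, hd, ?_, ?_, ?_⟩
  · refine eq_of_subset_of_card_le (union_subset ?_ ?_) ?_
    · intro x hx
      exact SameCycle.mem_of_mapsTo hKτ hn (mem_filter.1 hx).2
    · intro x hx
      exact SameCycle.mem_of_mapsTo hKτ hs (mem_filter.1 hx).2
    · rw [card_union_of_disjoint hd, hc1, hc2, h1, h3]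
      omega
  · rw [hc1, h1, hk]
  · rw [hc2, h3]

/-- A set invariant under `σ` is the union of the orbits which it contains. -/
theorem biUnion_filter_subset [Finite β] {σ : Perm β} {Q : Finset (Finset β)}
    (hQ : ∀ O ∈ Q, IsOrbit σ O) {B : Finset β} (hBQ : B ⊆ Q.biUnion id)
    (hB : ∀ x ∈ B, σ x ∈ B) : (Q.filter (· ⊆ B)).biUnion id = B := by
  ext x
  simp only [mem_biUnion, mem_filter, id]
  constructor
  · rintro ⟨O, ⟨-, hO⟩, hx⟩
    exact hO hx
  · intro hx
    obtain ⟨O, hO, hxO⟩ := mem_biUnion.1 (hBQ hx)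
    refine ⟨O, ⟨hO, fun y hy => ?_⟩, hxO⟩
    exact SameCycle.mem_of_mapsTo hB hx (((hQ O hO).mem_iff x hxO y).1 hy)

theorem biUnion_sdiff_biUnion {σ : Perm β} {Q T : Finset (Finset β)}
    (hQ : ∀ O ∈ Q, IsOrbit σ O) (hT : T ⊆ Q) :
    Q.biUnion id \ T.biUnion id = (Q \ T).biUnion id := by
  ext x
  simp only [mem_sdiff, mem_biUnion, id, not_exists, not_and]
  constructor
  · rintro ⟨⟨O, hO, hx⟩, h⟩
    exact ⟨O, ⟨hO, fun hOT => h O hOT hx⟩, hx⟩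
  · rintro ⟨O, ⟨hO, hOT⟩, hx⟩
    refine ⟨⟨O, hO, hx⟩, fun O' hO' hx' => hOT ?_⟩
    rwa [(hQ O hO).eq (hQ O' (hT hO')) hx hx']

end Orbits

/-! ### The genus zero formula on a finite set -/

section GenusZero

open Equiv Function

variable {β : Type*}

theorem two_le_sum_card_add_card {σ : Perm β} {P : Finset (Finset β)} (hP : P.Nonempty)
    (h : ∀ O ∈ P, IsOrbit σ O) : 2 ≤ ∑ O ∈ P, #O + #P := by
  have h1 : #P ≤ ∑ O ∈ P, #O := by
    rw [card_eq_sum_ones]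
    exact sum_le_sum fun O hO => (h O hO).nonempty.card_pos
  have := hP.card_pos
  omega

variable [LinearOrder β]

theorem card_biUnion_orbits {σ : Perm β} {P : Finset (Finset β)}
    (h : ∀ O ∈ P, IsOrbit σ O) : #(P.biUnion id) = ∑ O ∈ P, #O :=
  card_biUnion (pairwiseDisjoint_of_isOrbit h)

/-- The weight of a collection of orbits. -/
def orbitWeight (P : Finset (Finset β)) : ℚ :=
  ∏ O ∈ P, ((#O : ℚ) * (#O).centralBinom)

/-- The genus zero monotone Hurwitz number of a permutation with set of orbits `P`. -/
def hurwitzNumber (P : Finset (Finset β)) : ℚ :=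
  ((2 * ∑ O ∈ P, #O + #P - 3).factorial : ℚ) / (2 * ∑ O ∈ P, #O).factorial * orbitWeight P

theorem hurwitzNumber_insert {K : Finset β} {O : Finset (Finset β)} (hK : K.Nonempty)
    (hKO : K ∉ O) : hurwitzNumber (insert K O) = orbitWeight O * hurwitzCoeff card (#K - 1) O := by
  obtain ⟨r, hr⟩ := Nat.exists_eq_succ_of_ne_zero hK.card_pos.ne'
  rw [hurwitzNumber, orbitWeight, orbitWeight, prod_insert hKO, sum_insert hKO,
    card_insert_of_notMem hKO, hurwitzCoeff_eq, hr, Nat.succ_eq_add_one, Nat.add_sub_cancel,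
    show 2 * (r + 1 + ∑ i ∈ O, #i) + (#O + 1) - 3 = 2 * (r + 1 + ∑ i ∈ O, #i) + #O - 2 by omega]
  push_cast
  ring

theorem orbitWeight_mul_sdiff {O T : Finset (Finset β)} (hT : T ⊆ O) :
    orbitWeight T * orbitWeight (O \ T) = orbitWeight O := by
  rw [orbitWeight, orbitWeight, orbitWeight, mul_comm, prod_sdiff hT]

theorem sum_hurwitzCoeff_cut_join (K : ℕ) (O : Finset (Finset β)) (hO : K = 0 → O.Nonempty) :
    hurwitzCoeff card K O = ∑ i ∈ range K, ∑ T ∈ O.powerset,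
      hurwitzCoeff card (K - 1 - i) T * hurwitzCoeff card i (O \ T) +
        ∑ C ∈ O, hurwitzCoeff card (K + #C) (O.erase C) / (#C).centralBinom := by
  cases K with
  | zero => simpa using hurwitzCoeff_rec_zero card (hO rfl)
  | succ r =>
    rw [hurwitzCoeff_rec_succ, add_comm, Nat.add_sub_cancel]
    congr 1
    rw [← HasAntidiagonal.map_swap_antidiagonal, sum_map,
      Nat.sum_antidiagonal_eq_sum_range_succ_mk]
    rfl

theorem orbitWeight_erase_mul {O : Finset (Finset β)} {C : Finset β} (hC : C ∈ O) (x : ℚ) :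
    #C * (orbitWeight (O.erase C) * x) = orbitWeight O * (x / (#C).centralBinom) := by
  have h : ((#C).centralBinom : ℚ) ≠ 0 := Nat.cast_ne_zero.2 (Nat.centralBinom_ne_zero _)
  rw [orbitWeight, orbitWeight, ← mul_prod_erase O _ hC]
  field_simp

variable [Fintype β]

/-- The genus zero formula, for factorizations with `m` factors. -/
def GenusZeroFormula (β : Type*) [LinearOrder β] [Fintype β] (m : ℕ) : Prop :=
  ∀ (σ : Perm β) (P : Finset (Finset β)), P.Nonempty → (∀ O ∈ P, IsOrbit σ O) →
    (m + 2 < ∑ O ∈ P, #O + #P → #(factorizations m (P.biUnion id) σ) = 0) ∧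
    (m + 2 = ∑ O ∈ P, #O + #P → (#(factorizations m (P.biUnion id) σ) : ℚ) = hurwitzNumber P)

theorem sum_card_factorizations_mul {m : ℕ} (ih : ∀ d ≤ m, GenusZeroFormula β d) {τ : Perm β}
    {P Q : Finset (Finset β)} (hP : P.Nonempty) (hQ : Q.Nonempty) (hPτ : ∀ O ∈ P, IsOrbit τ O)
    (hQτ : ∀ O ∈ Q, IsOrbit τ O) :
    (m + 4 < (∑ O ∈ P, #O + #P) + (∑ O ∈ Q, #O + #Q) →
      ∑ p ∈ antidiagonal m, #(factorizations p.1 (P.biUnion id) τ) *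
        #(factorizations p.2 (Q.biUnion id) τ) = 0) ∧
    (m + 4 = (∑ O ∈ P, #O + #P) + (∑ O ∈ Q, #O + #Q) →
      ((∑ p ∈ antidiagonal m, #(factorizations p.1 (P.biUnion id) τ) *
        #(factorizations p.2 (Q.biUnion id) τ) : ℕ) : ℚ) = hurwitzNumber P * hurwitzNumber Q) := by
  have h1 := two_le_sum_card_add_card hP hPτ
  have h2 := two_le_sum_card_add_card hQ hQτ
  have hzero : ∀ p ∈ antidiagonal m, (p.1 + 2 < ∑ O ∈ P, #O + #P ∨ p.2 + 2 < ∑ O ∈ Q, #O + #Q) →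
      #(factorizations p.1 (P.biUnion id) τ) * #(factorizations p.2 (Q.biUnion id) τ) = 0 := by
    rintro p hp (h | h)
    · rw [(ih p.1 (by have := mem_antidiagonal.1 hp; omega) τ P hP hPτ).1 h, zero_mul]
    · rw [(ih p.2 (by have := mem_antidiagonal.1 hp; omega) τ Q hQ hQτ).1 h, mul_zero]
  constructor
  · intro h
    refine sum_eq_zero fun p hp => hzero p hp ?_
    have := mem_antidiagonal.1 hp
    omega
  · intro h
    rw [sum_eq_single (∑ O ∈ P, #O + #P - 2, ∑ O ∈ Q, #O + #Q - 2)]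
    · push_cast
      rw [(ih _ (by omega) τ P hP hPτ).2 (by omega), (ih _ (by omega) τ Q hQ hQτ).2 (by omega)]
    · rintro ⟨p₁, p₂⟩ hp hne
      refine hzero _ hp ?_
      have h3 := mem_antidiagonal.1 hp
      by_contra! h4
      exact hne (Prod.ext (by dsimp only at *; omega) (by dsimp only at *; omega))
    · intro h3
      exact absurd (by rw [HasAntidiagonal.mem_antidiagonal]; omega) h3

/-- The term of the recurrence of `card_factorizations_succ` for first factor `(s n)`. -/
noncomputable def cutJoinTerm (m : ℕ) (A : Finset β) (τ : Perm β) (s n : β) : ℕ :=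
  #(factorizations m A τ) + ∑ B ∈ (A.erase s).powerset.filter (n ∈ ·),
    ∑ p ∈ antidiagonal m, #(factorizations p.1 B τ) * #(factorizations p.2 (A \ B) τ)

theorem sum_antidiagonal_eq_zero {m : ℕ} {A B : Finset β} {τ : Perm β}
    (h : ¬ ∀ x ∈ B, τ x ∈ B) :
    ∑ p ∈ antidiagonal m, #(factorizations p.1 B τ) * #(factorizations p.2 (A \ B) τ) = 0 := by
  refine sum_eq_zero fun p _ => ?_
  rw [mul_eq_zero, card_eq_zero]
  left
  by_contra hne
  exact h fun x hx => apply_mem_of_factorizations_nonempty (nonempty_iff_ne_empty.2 hne) hx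

theorem cutJoinTerm_of_sameCycle (m : ℕ) (A : Finset β) {τ : Perm β} {s n : β}
    (h : τ.SameCycle n s) : cutJoinTerm m A τ s n = #(factorizations m A τ) := by
  rw [cutJoinTerm, Nat.add_eq_left]
  refine sum_eq_zero fun B hB => sum_antidiagonal_eq_zero fun hinv => ?_
  rw [mem_filter, mem_powerset] at hB
  exact notMem_erase s A (hB.1 (SameCycle.mem_of_mapsTo hinv hB.2 h))

theorem cutJoinTerm_join {m : ℕ} (ih : GenusZeroFormula β m) {σ : Perm β} {K C : Finset β}
    {O : Finset (Finset β)} (hKO : K ∉ O) (hσ : ∀ D ∈ insert K O, IsOrbit σ D) (hC : C ∈ O)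
    {s n : β} (hn : n ∈ K) (hs : s ∈ C) :
    (m + 3 < ∑ D ∈ insert K O, #D + #(insert K O) →
      cutJoinTerm m ((insert K O).biUnion id) (σ * swap s n) s n = 0) ∧
    (m + 3 = ∑ D ∈ insert K O, #D + #(insert K O) →
      (cutJoinTerm m ((insert K O).biUnion id) (σ * swap s n) s n : ℚ) =
        orbitWeight (O.erase C) * hurwitzCoeff card (#K - 1 + #C) (O.erase C)) := by
  have hK := hσ K (mem_insert_self K O)
  have hCσ := hσ C (mem_insert_of_mem hC)
  have hKC : K ≠ C := fun h => hKO (h ▸ hC)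
  have hJ := hK.join hCσ hKC hn hs
  have hdisj : Disjoint K C := pairwiseDisjoint_of_isOrbit hσ (mem_coe.2 (mem_insert_self K O))
    (mem_coe.2 (mem_insert_of_mem hC)) hKC
  have hJO : K ∪ C ∉ O.erase C := by
    intro h
    have h1 := hσ _ (mem_insert_of_mem (mem_of_mem_erase h))
    exact hKO (h1.eq hK (mem_union_left C hn) hn ▸ mem_of_mem_erase h)
  have horb : ∀ D ∈ insert (K ∪ C) (O.erase C), IsOrbit (σ * swap s n) D := by
    intro D hD
    rcases mem_insert.1 hD with rfl | hD
    · exact hJ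
    · rw [mem_erase] at hD
      have hDσ := hσ D (mem_insert_of_mem hD.2)
      refine hDσ.mul_swap_of_notMem (fun h => hD.1 (hDσ.eq hCσ h hs)) fun h => hKO ?_
      rw [← hDσ.eq hK h hn]
      exact hD.2
  have hA : (insert K O).biUnion id = (insert (K ∪ C) (O.erase C)).biUnion id := by
    conv_lhs => rw [← insert_erase hC]
    simp only [biUnion_insert, id, union_assoc]
  have hcard := card_union_of_disjoint hdisj
  have hsum : ∑ D ∈ insert (K ∪ C) (O.erase C), #D = ∑ D ∈ insert K O, #D := by
    rw [sum_insert hJO, sum_insert hKO, hcard, add_assoc, add_sum_erase O card hC]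
  have hcardP : #(insert (K ∪ C) (O.erase C)) + 1 = #(insert K O) := by
    rw [card_insert_of_notMem hJO, card_insert_of_notMem hKO, card_erase_add_one hC]
  have h := ih (σ * swap s n) _ (insert_nonempty _ _) horb
  rw [cutJoinTerm_of_sameCycle m _
    ((hJ.mem_iff n (mem_union_left C hn) s).1 (mem_union_right K hs)), hA, ← hcardP, ← hsum]
  refine ⟨fun hm => h.1 (by omega), fun hm => ?_⟩
  rw [h.2 (by omega), hurwitzNumber_insert hJ.nonempty hJO, hcard]
  have := hK.nonempty.card_pos
  rw [show #K + #C - 1 = #K - 1 + #C by omega]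

theorem cutJoinTerm_cut {m : ℕ} (ih : ∀ d ≤ m, GenusZeroFormula β d) {σ : Perm β}
    {K : Finset β} {O : Finset (Finset β)} (hKO : K ∉ O)
    (hσ : ∀ D ∈ insert K O, IsOrbit σ D) {n : β} (hn : n ∈ K) {i : ℕ} (hi : 0 < i)
    (hiK : i < #K) :
    (m + 3 < ∑ D ∈ insert K O, #D + #(insert K O) →
      cutJoinTerm m ((insert K O).biUnion id) (σ * swap (σ^[i] n) n) (σ^[i] n) n = 0) ∧
    (m + 3 = ∑ D ∈ insert K O, #D + #(insert K O) →
      (cutJoinTerm m ((insert K O).biUnion id) (σ * swap (σ^[i] n) n) (σ^[i] n) n : ℚ) =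
        orbitWeight O * ∑ T ∈ O.powerset,
          hurwitzCoeff card (#K - i - 1) T * hurwitzCoeff card (i - 1) (O \ T)) := by
  have hK := hσ K (mem_insert_self K O)
  obtain ⟨K₁, K₂, h1, h2, hn1, hs2, hdisj, hunion, hc1, hc2⟩ := hK.exists_cut hn hi hiK
  set s := σ^[i] n with hs
  set τ := σ * swap s n with hτ
  have hK1K : K₁ ⊆ K := hunion ▸ subset_union_left
  have hK2K : K₂ ⊆ K := hunion ▸ subset_union_right
  have hdO : ∀ D ∈ O, Disjoint K D := fun D hD =>
    pairwiseDisjoint_of_isOrbit hσ (mem_coe.2 (mem_insert_self K O))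
      (mem_coe.2 (mem_insert_of_mem hD)) fun h => hKO (h ▸ hD)
  have hK1O : K₁ ∉ O := fun h => disjoint_left.1 (hdO _ h) hn hn1
  have hK2O : K₂ ∉ O := fun h => disjoint_left.1 (hdO _ h) (hK2K hs2) hs2
  have hK12 : K₁ ≠ K₂ := fun h => disjoint_left.1 hdisj hn1 (h ▸ hn1)
  have hK1' : K₁ ∉ insert K₂ O := by simp [hK12, hK1O]
  have hOτ : ∀ D ∈ O, IsOrbit τ D := fun D hD =>
    (hσ D (mem_insert_of_mem hD)).mul_swap_of_notMem
      (fun h => disjoint_left.1 (hdO D hD) (hK2K hs2) h)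
      (fun h => disjoint_left.1 (hdO D hD) hn h)
  have horb : ∀ D ∈ insert K₁ (insert K₂ O), IsOrbit τ D := by
    simp only [forall_mem_insert]
    exact ⟨h1, h2, hOτ⟩
  have hA : (insert K O).biUnion id = (insert K₁ (insert K₂ O)).biUnion id := by
    simp only [biUnion_insert, id, ← union_assoc, hunion]
  have hsum : ∑ D ∈ insert K₁ (insert K₂ O), #D = ∑ D ∈ insert K O, #D := by
    rw [sum_insert hK1', sum_insert hK2O, sum_insert hKO, hc1, hc2]
    omega
  have hcardP : #(insert K₁ (insert K₂ O)) = #(insert K O) + 1 := by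
    rw [card_insert_of_notMem hK1', card_insert_of_notMem hK2O, card_insert_of_notMem hKO]
  have hsplit : ∑ B ∈ (((insert K O).biUnion id).erase s).powerset.filter (n ∈ ·),
      ∑ p ∈ antidiagonal m, #(factorizations p.1 B τ) *
        #(factorizations p.2 ((insert K O).biUnion id \ B) τ) =
      ∑ T ∈ O.powerset, ∑ p ∈ antidiagonal m,
        #(factorizations p.1 ((insert K₁ T).biUnion id) τ) *
          #(factorizations p.2 ((insert K₂ (O \ T)).biUnion id) τ) := by
    rw [hA]
    symm
    refine sum_of_injOn (fun T => (insert K₁ T).biUnion id) ?_ ?_ ?_ ?_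
    · intro T hT T' hT' hTT
      dsimp only at hTT
      rw [mem_coe, mem_powerset] at hT hT'
      have key : ∀ T ⊆ O, ∀ D ∈ O, D ∈ T ↔ D ⊆ (insert K₁ T).biUnion id := by
        intro T hT D hD
        refine ⟨fun h => subset_biUnion_of_mem id (mem_insert_of_mem h), fun h => ?_⟩
        obtain ⟨x, hx⟩ := (hOτ D hD).nonempty
        obtain ⟨E, hE, hxE⟩ := mem_biUnion.1 (h hx)
        rcases mem_insert.1 hE with rfl | hE
        · exact absurd hD ((hOτ D hD).eq h1 hx hxE ▸ hK1O)
        · rwa [(hOτ D hD).eq (hOτ E (hT hE)) hx hxE]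
      ext D
      constructor
      · intro hD
        exact (key T' hT' D (hT hD)).2 (hTT ▸ (key T hT D (hT hD)).1 hD)
      · intro hD
        exact (key T hT D (hT' hD)).2 (hTT ▸ (key T' hT' D (hT' hD)).1 hD)
    · intro T hT
      rw [mem_coe, mem_powerset] at hT
      rw [mem_coe, mem_filter, mem_powerset, subset_erase]
      refine ⟨⟨biUnion_subset_biUnion_of_subset_left _
        (insert_subset_insert _ (hT.trans (subset_insert _ _))), fun h => ?_⟩,
        mem_biUnion.2 ⟨K₁, mem_insert_self _ _, hn1⟩⟩
      obtain ⟨E, hE, hsE⟩ := mem_biUnion.1 h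
      rcases mem_insert.1 hE with rfl | hE
      · exact disjoint_left.1 hdisj hsE hs2
      · exact hK2O ((hOτ E (hT hE)).eq h2 hsE hs2 ▸ hT hE)
    · intro B hB hBim
      refine sum_antidiagonal_eq_zero fun hinv => hBim ?_
      rw [mem_filter, mem_powerset, subset_erase] at hB
      refine ⟨O.filter (· ⊆ B), mem_coe.2 (mem_powerset.2 (filter_subset _ _)), ?_⟩
      have h3 := biUnion_filter_subset horb hB.1.1 hinv
      rw [filter_insert, filter_insert, if_pos, if_neg] at h3
      · exact h3
      · exact fun h => hB.1.2 (h hs2)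
      · exact fun x hx => SameCycle.mem_of_mapsTo hinv hB.2 ((h1.mem_iff n hn1 x).1 hx)
    · intro T hT
      rw [mem_powerset] at hT
      rw [biUnion_sdiff_biUnion horb (insert_subset_insert _ (hT.trans (subset_insert _ _)))]
      have h3 : insert K₁ (insert K₂ O) \ insert K₁ T = insert K₂ (O \ T) := by
        ext D
        simp only [mem_sdiff, mem_insert]
        grind
      rw [h3]
  have hzero : m + 3 ≤ ∑ D ∈ insert K O, #D + #(insert K O) →
      #(factorizations m ((insert K O).biUnion id) τ) = 0 := by
    intro hm
    rw [hA]
    exact (ih m le_rfl τ _ (insert_nonempty _ _) horb).1 (by omega)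
  have hterm : ∀ T ∈ O.powerset, _ := fun T hT =>
    sum_card_factorizations_mul ih (insert_nonempty K₁ T) (insert_nonempty K₂ (O \ T))
      (fun D hD => horb D (insert_subset_insert _ ((mem_powerset.1 hT).trans
        (subset_insert _ _)) hD))
      (fun D hD => horb D (mem_insert_of_mem (insert_subset_insert _ sdiff_subset hD)))
  have hsize : ∀ T ∈ O.powerset, (∑ D ∈ insert K₁ T, #D + #(insert K₁ T)) +
      (∑ D ∈ insert K₂ (O \ T), #D + #(insert K₂ (O \ T))) =
      ∑ D ∈ insert K O, #D + #(insert K O) + 1 := by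
    intro T hT
    rw [mem_powerset] at hT
    have e1 := sum_sdiff (f := card) hT
    have e2 := card_sdiff_add_card_eq_card hT
    rw [sum_insert fun h => hK1O (hT h), sum_insert fun h => hK2O (sdiff_subset h),
      card_insert_of_notMem fun h => hK1O (hT h),
      card_insert_of_notMem fun h => hK2O (sdiff_subset h), sum_insert hKO,
      card_insert_of_notMem hKO, hc1, hc2]
    omega
  rw [cutJoinTerm, hsplit]
  constructor
  · intro hm
    rw [hzero hm.le, zero_add]
    refine sum_eq_zero fun T hT => (hterm T hT).1 ?_
    rw [hsize T hT]
    omega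
  · intro hm
    rw [hzero hm.le, zero_add, Nat.cast_sum, mul_sum]
    refine sum_congr rfl fun T hT => ?_
    rw [(hterm T hT).2 (by rw [hsize T hT]; omega),
      hurwitzNumber_insert h1.nonempty fun h => hK1O (mem_powerset.1 hT h),
      hurwitzNumber_insert h2.nonempty fun h => hK2O (sdiff_subset h), hc1, hc2,
      ← orbitWeight_mul_sdiff (mem_powerset.1 hT)]
    ring

theorem sum_erase_biUnion {M : Type*} [AddCommMonoid M] {σ : Perm β} {K : Finset β}
    {O : Finset (Finset β)} (hKO : K ∉ O) (hσ : ∀ D ∈ insert K O, IsOrbit σ D) {n : β}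
    (hn : n ∈ K) (f : β → M) :
    ∑ s ∈ ((insert K O).biUnion id).erase n, f s =
      ∑ i ∈ range (#K - 1), f (σ^[i + 1] n) + ∑ C ∈ O, ∑ s ∈ C, f s := by
  have hK := hσ K (mem_insert_self K O)
  have hdisj : (O : Set (Finset β)).PairwiseDisjoint id :=
    pairwiseDisjoint_of_isOrbit fun D hD => hσ D (mem_insert_of_mem hD)
  have hnO : n ∉ O.biUnion id := by
    intro h
    obtain ⟨D, hD, hnD⟩ := mem_biUnion.1 h
    exact hKO (hK.eq (hσ D (mem_insert_of_mem hD)) hn hnD ▸ hD)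
  have hKd : Disjoint (K.erase n) (O.biUnion id) := by
    rw [Finset.disjoint_left]
    intro x hx h
    obtain ⟨D, hD, hxD⟩ := mem_biUnion.1 h
    exact hKO (hK.eq (hσ D (mem_insert_of_mem hD)) (mem_of_mem_erase hx) hxD ▸ hD)
  have hKim : K.erase n = (range (#K - 1)).image fun i => σ^[i + 1] n := by
    have hpos := minimalPeriod_perm_pos σ n
    have h1 := hK.eq_image hn
    rw [← hK.card_eq hn] at h1 hpos
    have hinj := iterate_injOn_range σ n
    rw [← hK.card_eq hn, coe_range] at hinj
    conv_lhs => rw [h1]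
    ext x
    simp only [mem_erase, mem_image, mem_range]
    constructor
    · rintro ⟨hx, i, hi, rfl⟩
      rcases i with _ | i
      · exact absurd rfl hx
      · exact ⟨i, by omega, rfl⟩
    · rintro ⟨i, hi, rfl⟩
      refine ⟨fun h => ?_, i + 1, by omega, rfl⟩
      exact i.succ_ne_zero (hinj (show i + 1 < #K by omega) hpos h)
  rw [biUnion_insert, id, erase_union_distrib, erase_eq_of_notMem hnO, sum_union hKd,
    sum_biUnion hdisj, hKim, sum_image]
  · rfl
  · intro i hi j hj hij
    have hinj := iterate_injOn_range σ n
    rw [← hK.card_eq hn, coe_range] at hinj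
    rw [coe_range, Set.mem_Iio] at hi hj
    have := hinj (show i + 1 < #K by omega) (show j + 1 < #K by omega) hij
    omega

theorem genusZeroFormula_succ {m : ℕ} (ih : ∀ d ≤ m, GenusZeroFormula β d) :
    GenusZeroFormula β (m + 1) := by
  intro σ P hP hσ
  have hAne : (P.biUnion id).Nonempty := by
    obtain ⟨D, hD⟩ := hP
    obtain ⟨x, hx⟩ := (hσ D hD).nonempty
    exact ⟨x, mem_biUnion.2 ⟨D, hD, hx⟩⟩
  obtain ⟨K, hKP, hnK⟩ := mem_biUnion.1 (max'_mem _ hAne)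
  have hmax : ∀ a ∈ P.biUnion id, a ≤ (P.biUnion id).max' hAne := fun a ha => le_max' _ a ha
  have hnA := max'_mem _ hAne
  generalize (P.biUnion id).max' hAne = n at hnK hmax hnA
  obtain ⟨O, hKO, rfl⟩ : ∃ O, K ∉ O ∧ insert K O = P :=
    ⟨P.erase K, notMem_erase K P, insert_erase hKP⟩
  clear hKP
  rw [id] at hnK
  have hK := hσ K (mem_insert_self K O)
  have hcard := card_biUnion_orbits hσ
  by_cases hA : (insert K O).biUnion id = {n}
  · have h1 : ∑ D ∈ insert K O, #D = 1 := by rw [← hcard, hA, card_singleton]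
    have h2 : #(insert K O) ≤ ∑ D ∈ insert K O, #D := by
      rw [card_eq_sum_ones]
      exact sum_le_sum fun D hD => (hσ D hD).nonempty.card_pos
    constructor <;> intro h <;> omega
  have hrec := card_factorizations_succ m σ hnA hmax hA
  change _ = ∑ s ∈ _, cutJoinTerm m ((insert K O).biUnion id) (σ * swap s n) s n at hrec
  rw [sum_erase_biUnion hKO hσ hnK] at hrec
  have hcut := fun i (hi : i ∈ range (#K - 1)) => cutJoinTerm_cut ih hKO hσ hnK i.succ_pos
    (by have := mem_range.1 hi; omega)
  have hjoin := fun C (hC : C ∈ O) s (hs : s ∈ C) =>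
    cutJoinTerm_join (ih m le_rfl) hKO hσ hC hnK hs
  rw [hrec]
  constructor
  · intro h
    rw [sum_eq_zero fun i hi => (hcut i hi).1 (by omega),
      sum_eq_zero fun C hC => sum_eq_zero fun s hs => (hjoin C hC s hs).1 (by omega), add_zero]
  · intro h
    push_cast
    rw [sum_congr rfl fun i hi => (hcut i hi).2 (by omega),
      sum_congr rfl fun C hC => sum_congr rfl fun s hs => (hjoin C hC s hs).2 (by omega),
      hurwitzNumber_insert hK.nonempty hKO, sum_hurwitzCoeff_cut_join, mul_add, mul_sum, mul_sum]
    · congr 1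
      · refine sum_congr rfl fun i _ => ?_
        rw [Nat.succ_eq_add_one, Nat.add_sub_cancel,
          show #K - (i + 1) - 1 = #K - 1 - 1 - i by omega]
      · refine sum_congr rfl fun C hC => ?_
        rw [sum_const, nsmul_eq_mul, orbitWeight_erase_mul hC]
    · intro h1
      by_contra hO
      rw [not_nonempty_iff_eq_empty] at hO
      subst hO
      have hpos := hK.nonempty.card_pos
      obtain ⟨x, hx⟩ := card_eq_one.1 (show #K = 1 by omega)
      refine hA ?_
      rw [hx] at hnK
      rw [mem_singleton.1 hnK, insert_empty_eq, singleton_biUnion, id, hx]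

theorem genusZeroFormula_zero : GenusZeroFormula β 0 := by
  intro σ P hP hσ
  have hcard := card_biUnion_orbits hσ
  have hPpos := hP.card_pos
  have hle : #P ≤ ∑ D ∈ P, #D := by
    rw [card_eq_sum_ones]
    exact sum_le_sum fun D hD => (hσ D hD).nonempty.card_pos
  constructor
  · intro h
    rw [card_eq_zero, eq_empty_iff_forall_notMem]
    intro l hl
    obtain ⟨hl, -, -, hconn⟩ := mem_factorizations.1 hl
    rw [List.length_eq_zero_iff] at hl
    subst hl
    have hAne : (P.biUnion id).Nonempty := by
      rw [← card_pos]
      omega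
    obtain ⟨x, hx⟩ := hAne
    have h1 := hconn {x} (singleton_subset_iff.2 hx) (singleton_nonempty x) (by simp [IsSaturated])
    rw [← h1, card_singleton] at hcard
    omega
  · intro h
    obtain ⟨K, rfl⟩ := card_eq_one.1 (show #P = 1 by omega)
    have hK := hσ K (mem_singleton_self K)
    rw [sum_singleton, card_singleton] at h
    obtain ⟨x, rfl⟩ := card_eq_one.1 (show #K = 1 by omega)
    have hx : σ x = x := mem_singleton.1 (hK.apply_mem (mem_singleton_self x))
    have h1 : factorizations 0 (({{x}} : Finset (Finset β)).biUnion id) σ = {[]} := by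
      ext l
      rw [mem_factorizations, mem_singleton, List.length_eq_zero_iff]
      refine ⟨fun h => h.1, ?_⟩
      rintro rfl
      refine ⟨rfl, ⟨by simp, by simp, by simp, by simp⟩, by simp [swapProd, hx], ?_⟩
      rw [singleton_biUnion, id]
      intro B hB hne _
      exact (subset_singleton_iff.1 hB).resolve_left hne.ne_empty
    rw [h1, card_singleton, hurwitzNumber, orbitWeight]
    norm_num [Nat.centralBinom, Nat.factorial]

theorem genusZeroFormula (m : ℕ) : GenusZeroFormula β m := by
  induction m using Nat.strong_induction_on with
  | _ m ih =>
    cases m with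
    | zero => exact genusZeroFormula_zero
    | succ m => exact genusZeroFormula_succ fun d hd => ih d (by omega)

end GenusZero

/-! ### Factorizations as tuples of transpositions, and the cycle type -/

section CycleType

open Equiv

section Tuples

variable {β : Type*} [LinearOrder β] {m : ℕ}

theorem isMonotoneList_reverse_ofFn [Fintype β] (e : Fin m → β × β) :
    IsMonotoneList univ (List.ofFn e).reverse ↔
      (∀ i, (e i).1 < (e i).2) ∧ Monotone fun i => (e i).2 := by
  have h : (List.ofFn e).reverse.Pairwise (fun e e' => e'.2 ≤ e.2) ↔
      Monotone fun i => (e i).2 := by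
    rw [List.pairwise_reverse, List.pairwise_ofFn, monotone_iff_forall_lt]
  rw [← h]
  constructor
  · intro hl
    exact ⟨fun i => hl.lt _ (by simp), hl.pairwise⟩
  · rintro ⟨h1, h2⟩
    refine ⟨fun x hx => ?_, by simp, by simp, h2⟩
    rw [List.mem_reverse, List.mem_ofFn] at hx
    obtain ⟨i, rfl⟩ := hx
    exact h1 i

theorem swapProd_reverse_ofFn (e : Fin m → β × β) :
    swapProd (List.ofFn e).reverse = (List.ofFn fun i => swap (e i).1 (e i).2).prod := by
  rw [swapProd, List.reverse_reverse, List.map_ofFn]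
  rfl

theorem isConn_reverse_ofFn [Fintype β] [Nonempty β] (e : Fin m → β × β) :
    IsConn univ (List.ofFn e).reverse ↔
      ∀ a b : β, ∃ g ∈ Subgroup.closure (Set.range fun i => swap (e i).1 (e i).2), g a = b := by
  classical
  constructor
  · intro h a b
    have hB := h (univ.filter fun b =>
      ∃ g ∈ Subgroup.closure (Set.range fun i => swap (e i).1 (e i).2), g a = b)
      (subset_univ _) ⟨a, mem_filter.2 ⟨mem_univ a, 1, one_mem _, rfl⟩⟩ ?_
    · have hb := mem_univ b
      rw [← hB, mem_filter] at hb
      exact hb.2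
    · intro x hx
      rw [List.mem_reverse, List.mem_ofFn] at hx
      obtain ⟨i, rfl⟩ := hx
      have hi : swap (e i).1 (e i).2 ∈
          Subgroup.closure (Set.range fun i => swap (e i).1 (e i).2) :=
        Subgroup.subset_closure ⟨i, rfl⟩
      simp only [mem_filter, mem_univ, true_and]
      constructor
      · rintro ⟨g, hg, h⟩
        exact ⟨_, mul_mem hi hg, by rw [Perm.mul_apply, h, swap_apply_left]⟩
      · rintro ⟨g, hg, h⟩
        exact ⟨_, mul_mem hi hg, by rw [Perm.mul_apply, h, swap_apply_right]⟩
  · rintro h B - ⟨a, ha⟩ hB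
    rw [eq_univ_iff_forall]
    intro b
    obtain ⟨g, hg, rfl⟩ := h a b
    suffices hinv : ∀ x, g x ∈ B ↔ x ∈ B from (hinv a).2 ha
    clear ha h
    induction hg using Subgroup.closure_induction with
    | mem g hg =>
      obtain ⟨i, rfl⟩ := hg
      have hi := hB (e i) (by simp)
      intro x
      dsimp only
      rw [swap_apply_def]
      split_ifs with h1 h2
      · rw [h1, hi]
      · rw [h2, hi]
      · rfl
    | one => simp
    | mul g g' _ _ ih ih' => exact fun x => (ih _).trans (ih' x)
    | inv g _ ih =>
      intro x
      rw [← ih, ← Perm.mul_apply, mul_inv_cancel, Perm.one_apply]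

theorem swap_pair_injective {p q : β × β} (hp : p.1 < p.2) (hq : q.1 < q.2)
    (h : swap p.1 p.2 = swap q.1 q.2) : p = q := by
  have h1 := congrArg (· p.1) h
  have h2 := congrArg (· p.2) h
  simp only [swap_apply_left, swap_apply_right, swap_apply_def] at h1 h2
  ext1 <;> grind

theorem natCard_tuples_eq [Fintype β] [Nonempty β] (σ : Perm β) :
    Nat.card {f : Fin m → Perm β // (List.ofFn f).prod = σ ∧
      (∃ t : Fin m → β, Monotone t ∧ ∀ i, ∃ s : β, s < t i ∧ f i = swap s (t i)) ∧
      ∀ a b : β, ∃ g ∈ Subgroup.closure (Set.range f), g a = b} =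
    #(factorizations m univ σ) := by
  set S : Set (Fin m → β × β) := {e | (List.ofFn e).reverse ∈ factorizations m univ σ} with hS
  have hmem : ∀ e : Fin m → β × β, e ∈ S ↔
      ((∀ i, (e i).1 < (e i).2) ∧ Monotone fun i => (e i).2) ∧
      (List.ofFn fun i => swap (e i).1 (e i).2).prod = σ ∧
      ∀ a b : β, ∃ g ∈ Subgroup.closure (Set.range fun i => swap (e i).1 (e i).2), g a = b := by
    intro e
    rw [hS, Set.mem_ofPred_eq, mem_factorizations, isMonotoneList_reverse_ofFn,
      isConn_reverse_ofFn, swapProd_reverse_ofFn, Perm.ext_iff]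
    simp
  have h1 : (fun e : Fin m → β × β => (List.ofFn e).reverse) '' S =
      (factorizations m univ σ : Set (List (β × β))) := by
    ext l
    constructor
    · rintro ⟨e, he, rfl⟩
      exact he
    · intro hl
      obtain ⟨k, e, he⟩ : ∃ (k : ℕ) (e : Fin k → β × β), l.reverse = List.ofFn e :=
        List.exists_iff_exists_tuple.1 ⟨l.reverse, rfl⟩
      have hk := (mem_factorizations.1 (mem_coe.1 hl)).1
      rw [← List.length_reverse, he, List.length_ofFn] at hk
      subst hk
      have hel : (List.ofFn e).reverse = l := by rw [← he, List.reverse_reverse]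
      refine ⟨e, ?_, hel⟩
      rw [hS, Set.mem_ofPred_eq, hel]
      exact hl
  have h2 : (fun (e : Fin m → β × β) i => swap (e i).1 (e i).2) '' S =
      {f : Fin m → Perm β | (List.ofFn f).prod = σ ∧
        (∃ t : Fin m → β, Monotone t ∧ ∀ i, ∃ s : β, s < t i ∧ f i = swap s (t i)) ∧
        ∀ a b : β, ∃ g ∈ Subgroup.closure (Set.range f), g a = b} := by
    ext f
    constructor
    · rintro ⟨e, he, rfl⟩
      rw [hmem] at he
      exact ⟨he.2.1, ⟨fun i => (e i).2, he.1.2, fun i => ⟨(e i).1, he.1.1 i, rfl⟩⟩, he.2.2⟩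
    · rintro ⟨h1, ⟨t, ht, h2⟩, h3⟩
      choose s hs hst using h2
      obtain rfl : f = fun i => swap (s i) (t i) := funext hst
      exact ⟨fun i => (s i, t i), (hmem _).2 ⟨⟨hs, ht⟩, h1, h3⟩, rfl⟩
  rw [← Set.coe_ofPred, ← h2, Nat.card_coe_set_eq, Set.InjOn.ncard_image,
    ← Set.InjOn.ncard_image (f := fun e : Fin m → β × β => (List.ofFn e).reverse) (s := S), h1,
    Set.ncard_coe_finset]
  · intro e _ e' _ h
    exact List.ofFn_injective (List.reverse_injective h)
  · intro e he e' he' h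
    rw [hmem] at he he'
    exact funext fun i => swap_pair_injective (he.1.1 i) (he'.1.1 i) (congrFun h i)

end Tuples

variable {β : Type*} [DecidableEq β] [Fintype β]

/-- The set of orbits of `σ`. -/
def orbits (σ : Perm β) : Finset (Finset β) :=
  σ.cycleFactorsFinset.image Perm.support ∪ σ.supportᶜ.image singleton

theorem isOrbit_of_mem_orbits {σ : Perm β} {O : Finset β} (h : O ∈ orbits σ) : IsOrbit σ O := by
  rw [orbits, mem_union, mem_image, mem_image] at h
  rcases h with ⟨c, hc, rfl⟩ | ⟨x, hx, rfl⟩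
  · refine ⟨((Perm.mem_cycleFactorsFinset_iff.1 hc).1).nonempty_support, fun x hx y => ?_⟩
    rw [Perm.cycle_is_cycleOf hx hc, Perm.mem_support_cycleOf_iff]
    exact and_iff_left (Perm.mem_cycleFactorsFinset_support_le hc hx)
  · rw [mem_compl, Perm.notMem_support] at hx
    refine IsOrbit.of_mapsTo (mem_singleton_self x) ?_ ?_
    · simpa using hx
    · simp [Perm.SameCycle.refl]

theorem biUnion_orbits (σ : Perm β) : (orbits σ).biUnion id = univ := by
  rw [eq_univ_iff_forall]
  intro x
  rw [mem_biUnion]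
  by_cases hx : x ∈ σ.support
  · refine ⟨(σ.cycleOf x).support, mem_union_left _ (mem_image_of_mem _
      (Perm.cycleOf_mem_cycleFactorsFinset_iff.2 hx)), ?_⟩
    rw [id, Perm.mem_support_cycleOf_iff]
    exact ⟨Perm.SameCycle.refl σ x, hx⟩
  · exact ⟨{x}, mem_union_right _ (mem_image_of_mem _ (mem_compl.2 hx)), mem_singleton_self x⟩

theorem map_card_orbits (σ : Perm β) : (orbits σ).val.map card = σ.partition.parts := by
  have hinj : Set.InjOn Perm.support (σ.cycleFactorsFinset : Set (Perm β)) := by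
    intro c hc d hd hcd
    obtain ⟨x, hx⟩ := ((Perm.mem_cycleFactorsFinset_iff.1 hc).1).nonempty_support
    rw [Perm.cycle_is_cycleOf hx hc, Perm.cycle_is_cycleOf (hcd ▸ hx) hd]
  have hdisj : Disjoint (σ.cycleFactorsFinset.image Perm.support)
      (σ.supportᶜ.image singleton) := by
    rw [Finset.disjoint_left]
    intro O hO hO'
    obtain ⟨c, hc, rfl⟩ := mem_image.1 hO
    obtain ⟨x, hx, hxc⟩ := mem_image.1 hO'
    have h := ((Perm.mem_cycleFactorsFinset_iff.1 hc).1).two_le_card_support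
    rw [← hxc, card_singleton] at h
    omega
  rw [orbits, ← disjUnion_eq_union _ _ hdisj, disjUnion_val, Multiset.map_add,
    image_val_of_injOn hinj, image_val_of_injOn (singleton_injective.injOn), Multiset.map_map,
    Multiset.map_map, Perm.parts_partition, Perm.cycleType_def]
  congr 1
  rw [← card_compl, card_def, ← Multiset.map_const']
  rfl

theorem orbitWeight_orbits {β : Type*} [LinearOrder β] [Fintype β] (σ : Perm β) :
    orbitWeight (orbits σ) =
      (σ.partition.parts.map fun a : ℕ => (a : ℚ) * ((2 * a).choose a : ℚ)).prod := by
  rw [← map_card_orbits, Multiset.map_map]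
  rfl

end CycleType

end MonotoneHurwitz

/-- Genus-0 monotone Hurwitz number formula: for `σ ∈ S_n` with full cycle type `α`
(fixed points included) having `ℓ` parts, and `m = n + ℓ - 2`, the number of transitive
factorizations of `σ` into `m` transpositions `(sᵢ tᵢ)` with `sᵢ < tᵢ` and
`t₁ ≤ t₂ ≤ ⋯ ≤ t_m` equals `((2n + ℓ - 3)! / (2n)!) · ∏_j α_j · C(2α_j, α_j)`. -/
theorem stmt4 (n : ℕ) (hn : 1 ≤ n) (σ : Equiv.Perm (Fin n))
    (ℓ : ℕ) (hℓ : ℓ = σ.partition.parts.card)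
    (m : ℕ) (hm : m = n + ℓ - 2) :
    (Nat.card {f : Fin m → Equiv.Perm (Fin n) //
        (List.ofFn f).prod = σ ∧
        (∃ t : Fin m → Fin n, Monotone t ∧
          ∀ i, ∃ s : Fin n, s < t i ∧ f i = Equiv.swap s (t i)) ∧
        ∀ a b : Fin n, ∃ g ∈ Subgroup.closure (Set.range f), g a = b} : ℚ) =
      ((2 * n + ℓ - 3).factorial : ℚ) / ((2 * n).factorial : ℚ) *
        (σ.partition.parts.map
          (fun a : ℕ => (a : ℚ) * ((2 * a).choose a : ℚ))).prod := by
  have : NeZero n := ⟨by omega⟩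
  have hsum : ∑ O ∈ MonotoneHurwitz.orbits σ, O.card = n := by
    rw [← MonotoneHurwitz.card_biUnion_orbits fun O => MonotoneHurwitz.isOrbit_of_mem_orbits,
      MonotoneHurwitz.biUnion_orbits, Finset.card_univ, Fintype.card_fin]
  have hcard : (MonotoneHurwitz.orbits σ).card = ℓ := by
    rw [hℓ, ← MonotoneHurwitz.map_card_orbits, Multiset.card_map, Finset.card_def]
  have hne : (MonotoneHurwitz.orbits σ).Nonempty := by
    rw [Finset.nonempty_iff_ne_empty]
    intro h
    rw [h, Finset.sum_empty] at hsum
    omega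
  have hpos := hne.card_pos
  have h := (MonotoneHurwitz.genusZeroFormula m σ _ hne
    fun O => MonotoneHurwitz.isOrbit_of_mem_orbits).2 (by omega)
  rw [MonotoneHurwitz.natCard_tuples_eq, ← MonotoneHurwitz.biUnion_orbits σ, h,
    MonotoneHurwitz.hurwitzNumber, hsum, hcard, MonotoneHurwitz.orbitWeight_orbits]
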